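/- If μ is an n-rectifiable Radon measure on ℝ^d, then for μ-almost every x, ∫_0^1 bβ_{μ,2}(x,r)^2 dr/r < ∞. -/

import Mathlib

open MeasureTheory Metric Set
open scoped ENNReal NNReal

noncomputable section


/-- The (closed) support of a measure. -/
def msupport {d : ℕ} (μ : Measure (EuclideanSpace ℝ (Fin d))) : Set (EuclideanSpace ℝ (Fin d)) :=
  {x | ∀ ε > 0, 0 < μ (ball x ε)}

/-- `L` is an `n`-plane (affine subspace of dimension `n`). -/
def IsPlane {d : ℕ} (n : ℕ) (L : AffineSubspace ℝ (EuclideanSpace ℝ (Fin d))) : Prop :=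
  Module.finrank ℝ L.direction = n

/-- The squared bilateral beta number `bβ_{ν,2}(x,r)^2`. -/
def bbeta2sq {d : ℕ} (n : ℕ) (ν : Measure (EuclideanSpace ℝ (Fin d)))
    (x : EuclideanSpace ℝ (Fin d)) (r : ℝ) : ℝ≥0∞ :=
  ⨅ (L : AffineSubspace ℝ (EuclideanSpace ℝ (Fin d))) (_ : IsPlane n L),
    (ENNReal.ofReal r ^ n)⁻¹ *
      ((∫⁻ y in ball x r, (EMetric.infEdist y (L : Set (EuclideanSpace ℝ (Fin d))) /
          ENNReal.ofReal r) ^ 2 ∂ν) +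
        ∫⁻ y in ball x r ∩ (L : Set (EuclideanSpace ℝ (Fin d))),
          (EMetric.infEdist y (msupport ν) / ENNReal.ofReal r) ^ 2 ∂μH[(n : ℝ)])

/-- `μ` is an `n`-rectifiable measure: `μ ≪ H^n` and `μ`-almost all of the space is covered by
countably many Lipschitz images of `ℝ^n`. -/
def IsRectifiableMeasure {d : ℕ} (n : ℕ) (μ : Measure (EuclideanSpace ℝ (Fin d))) : Prop :=
  μ ≪ μH[(n : ℝ)] ∧
    ∃ f : ℕ → (EuclideanSpace ℝ (Fin n) → EuclideanSpace ℝ (Fin d)),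
      (∀ i, ∃ K : ℝ≥0, LipschitzWith K (f i)) ∧ μ (univ \ ⋃ i, range (f i)) = 0

abbrev EE (n : ℕ) := EuclideanSpace ℝ (Fin n)

/-- second difference -/
def sdiff2 {n d : ℕ} (f : EE n → EE d) (w k : EE n) : EE d := f (w + k) + f (w - k) - (2:ℝ) • f w

def DD {n d : ℕ} (f : EE n → EE d) (k : EE n) : ℝ≥0∞ := ∫⁻ w, ‖sdiff2 f w k‖ₑ ^ 2

def NN {n d : ℕ} (f : EE n → EE d) (k : EE n) : ℝ≥0∞ := ∫⁻ w, ‖f (w + k) - f w‖ₑ ^ 2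

/-- The rescaled square function density. -/
def WW {n d : ℕ} (f : EE n → EE d) (z : EE n) (ρ : ℝ) : ℝ≥0∞ :=
  ∫⁻ k in ball (0 : EE n) 2, ∫⁻ w in ball (0 : EE n) 2, ‖sdiff2 f (z + ρ • w) (ρ • k)‖ₑ ^ 2

lemma enorm_parallelogram {d : ℕ} (a b : EE d) :
    ‖a - b‖ₑ ^ 2 + ‖a + b‖ₑ ^ 2 = 2 * ‖a‖ₑ ^ 2 + 2 * ‖b‖ₑ ^ 2 := by
  have h := parallelogram_law_with_norm ℝ a b
  have e : ∀ x : EE d, ‖x‖ₑ ^ 2 = ENNReal.ofReal (‖x‖ ^ 2) := fun x => by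
    rw [← ofReal_norm, ENNReal.ofReal_pow (norm_nonneg _)]
  have two : (2 : ℝ≥0∞) = ENNReal.ofReal 2 := by simp
  have t : ∀ x : ℝ, 2 * ENNReal.ofReal x = ENNReal.ofReal (2 * x) := fun x => by
    rw [ENNReal.ofReal_mul (by norm_num), ← two]
  rw [e, e, e, e, t, t, ← ENNReal.ofReal_add (by positivity) (by positivity),
    ← ENNReal.ofReal_add (by positivity) (by positivity)]
  congr 1
  nlinarith

lemma DD_add_NN {n d : ℕ} (f : EE n → EE d) (hf : Continuous f) (k : EE n) :
    DD f k + NN f ((2:ℝ) • k) = 4 * NN f k := by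
  have h1 : NN f ((2:ℝ) • k) = ∫⁻ w, ‖f (w + k) - f (w - k)‖ₑ ^ 2 := by
    unfold NN
    rw [← lintegral_sub_right_eq_self (μ := volume) _ k]
    congr 1; ext w; congr 4
    rw [two_smul]; abel
  have h2 : NN f k = ∫⁻ w, ‖f w - f (w - k)‖ₑ ^ 2 := by
    unfold NN
    rw [← lintegral_sub_right_eq_self (μ := volume) _ k]
    congr 1; ext w; congr 4
    abel
  have e : (4 : ℝ≥0∞) * NN f k = 2 * NN f k + 2 * NN f k := by ring
  rw [e, h1]
  nth_rw 2 [h2]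
  unfold NN DD
  rw [← lintegral_const_mul _ (by fun_prop), ← lintegral_const_mul _ (by fun_prop),
    ← lintegral_add_right _ (by fun_prop), ← lintegral_add_right _ (by fun_prop)]
  congr 1; ext w
  rw [← enorm_parallelogram]
  have i1 : sdiff2 f w k = f (w + k) - f w - (f w - f (w - k)) := by
    unfold sdiff2; rw [two_smul]; abel
  have i2 : f (w + k) - f (w - k) = f (w + k) - f w + (f w - f (w - k)) := by abel
  rw [i1, i2]

lemma NN_le {n d : ℕ} (f : EE n → EE d) (K : ℝ≥0) (hf : LipschitzWith K f) (ρ : ℝ)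
    (hs : ∀ w, w ∉ ball (0 : EE n) ρ → f w = 0) (k : EE n) :
    NN f k ≤ (2 * K ^ 2 * volume (ball (0 : EE n) ρ)) * ‖k‖ₑ ^ 2 := by
  set B := ball (0 : EE n) ρ
  have hp : ∀ w, ‖f (w + k) - f w‖ₑ ^ 2 ≤
      (K * ‖k‖ₑ) ^ 2 * (B.indicator 1 w) + (K * ‖k‖ₑ) ^ 2 * (B.indicator 1 (w + k)) := by
    intro w
    have h1 : ‖f (w + k) - f w‖ₑ ≤ K * ‖k‖ₑ := by
      have := hf (w + k) w
      rwa [edist_eq_enorm_sub, edist_eq_enorm_sub, add_sub_cancel_left] at this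
    by_cases hw : w ∈ B
    · simp only [hw, indicator_of_mem, Pi.one_apply, mul_one]
      exact (pow_le_pow_left' h1 2).trans le_self_add
    · by_cases hw' : w + k ∈ B
      · simp only [hw', indicator_of_mem, Pi.one_apply, mul_one]
        exact (pow_le_pow_left' h1 2).trans le_add_self
      · rw [hs _ hw, hs _ hw']; simp
  have hB : MeasurableSet B := measurableSet_ball
  have hm : Measurable (B.indicator (1 : EE n → ℝ≥0∞)) := measurable_one.indicator hB
  calc NN f k ≤ ∫⁻ w, ((K * ‖k‖ₑ) ^ 2 * (B.indicator 1 w) + (K * ‖k‖ₑ) ^ 2 * (B.indicator 1 (w + k))) :=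
        lintegral_mono hp
    _ = _ := by
      rw [lintegral_add_left (by fun_prop), lintegral_const_mul _ hm,
        lintegral_const_mul _ (by fun_prop), lintegral_add_right_eq_self (μ := volume)
          (B.indicator (1 : EE n → ℝ≥0∞)) k, lintegral_indicator_one hB]
      ring

lemma DD_sum_le {n d : ℕ} (f : EE n → EE d) (K : ℝ≥0) (hf : LipschitzWith K f) (ρ : ℝ)
    (hs : ∀ w, w ∉ ball (0 : EE n) ρ → f w = 0) (k : EE n) :
    ∑' j : ℕ, (4 : ℝ≥0∞) ^ j * DD f (((2:ℝ)⁻¹ ^ j) • k) ≤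
      4 * ((2 * K ^ 2 * volume (ball (0 : EE n) ρ)) * ‖k‖ₑ ^ 2) := by
  have key : ∀ J : ℕ, ∑ j ∈ Finset.range J, (4 : ℝ≥0∞) ^ j * DD f (((2:ℝ)⁻¹ ^ j) • k)
      + NN f ((2:ℝ) • k) = 4 ^ J * NN f ((2:ℝ) • ((2:ℝ)⁻¹ ^ J) • k) := by
    intro J
    induction J with
    | zero => simp
    | succ J ih =>
      rw [Finset.sum_range_succ, add_right_comm, ih, ← mul_add, add_comm,
        DD_add_NN f hf.continuous, pow_succ, mul_assoc]
      congr 3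
      rw [smul_smul]; congr 1; rw [pow_succ]; field_simp
  rw [ENNReal.tsum_eq_iSup_nat]
  refine iSup_le fun J => ?_
  refine (le_self_add (b := NN f ((2:ℝ) • k))).trans ?_
  rw [key J]
  refine (mul_le_mul_right (NN_le f K hf ρ hs _) _).trans (le_of_eq ?_)
  rw [enorm_smul, enorm_smul, enorm_pow]
  have h2 : ‖(2:ℝ)‖ₑ = 2 := by rw [← ofReal_norm]; simp
  have h3 : ‖(2:ℝ)⁻¹‖ₑ = 2⁻¹ := by
    rw [← ofReal_norm, norm_inv, ENNReal.ofReal_inv_of_pos (by simp)]; simp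
  rw [h2, h3]
  have h4 : (4:ℝ≥0∞) ^ J * ((2⁻¹ : ℝ≥0∞) ^ J) ^ 2 = 1 := by
    rw [← pow_mul, mul_comm J 2, pow_mul, ← mul_pow]
    have : (4:ℝ≥0∞) * 2⁻¹ ^ 2 = 1 := by
      rw [show (4:ℝ≥0∞) = 2 ^ 2 by norm_num, ← mul_pow, ENNReal.mul_inv_cancel (by simp) (by simp)]
      simp
    rw [this, one_pow]
  calc _ = ((4:ℝ≥0∞) ^ J * ((2⁻¹ : ℝ≥0∞) ^ J) ^ 2) * (2 ^ 2 * (2 * K ^ 2 * volume (ball (0 : EE n) ρ) * ‖k‖ₑ ^ 2)) := by ring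
    _ = _ := by rw [h4]; norm_num

lemma continuous_sdiff2 {n d : ℕ} {f : EE n → EE d} (hf : Continuous f) :
    Continuous (fun p : EE n × EE n => sdiff2 f p.1 p.2) := by
  unfold sdiff2; fun_prop

lemma WW_integral {n d : ℕ} (f : EE n → EE d) (hf : Continuous f) (ρ : ℝ) :
    ∫⁻ z, WW f z ρ = volume (ball (0 : EE n) 2) * ∫⁻ k in ball (0 : EE n) 2, DD f (ρ • k) := by
  unfold WW
  have hc := continuous_sdiff2 hf
  have hm : Measurable (fun p : (EE n × EE n) × EE n =>
      ‖sdiff2 f (p.1.1 + ρ • p.2) (ρ • p.1.2)‖ₑ ^ 2) := by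
    have : Continuous (fun p : (EE n × EE n) × EE n =>
      sdiff2 f (p.1.1 + ρ • p.2) (ρ • p.1.2)) :=
      hc.comp (f := fun p : (EE n × EE n) × EE n => (p.1.1 + ρ • p.2, ρ • p.1.2)) (by fun_prop)
    exact (this.enorm.measurable).pow_const 2
  rw [lintegral_lintegral_swap (hm.lintegral_prod_right').aemeasurable,
    ← lintegral_const_mul' _ _ measure_ball_lt_top.ne]
  refine lintegral_congr fun k => ?_
  rw [lintegral_lintegral_swap]
  · have : ∀ w : EE n, ∫⁻ z, ‖sdiff2 f (z + ρ • w) (ρ • k)‖ₑ ^ 2 = DD f (ρ • k) := fun w =>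
      lintegral_add_right_eq_self (μ := volume) (fun z => ‖sdiff2 f z (ρ • k)‖ₑ ^ 2) (ρ • w)
    simp_rw [this]
    rw [lintegral_const, mul_comm]; simp
  · exact (hm.comp (f := fun p : EE n × EE n => ((p.1, k), p.2)) (by fun_prop)).aemeasurable

lemma WW_measurable {n d : ℕ} (f : EE n → EE d) (hf : Continuous f) (ρ : ℝ) :
    Measurable (fun z => WW f z ρ) := by
  have hc := continuous_sdiff2 hf
  have hm : Measurable (fun p : (EE n × EE n) × EE n =>
      ‖sdiff2 f (p.1.1 + ρ • p.2) (ρ • p.1.2)‖ₑ ^ 2) := by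
    have : Continuous (fun p : (EE n × EE n) × EE n =>
      sdiff2 f (p.1.1 + ρ • p.2) (ρ • p.1.2)) :=
      hc.comp (f := fun p : (EE n × EE n) × EE n => (p.1.1 + ρ • p.2, ρ • p.1.2)) (by fun_prop)
    exact (this.enorm.measurable).pow_const 2
  unfold WW
  exact (hm.lintegral_prod_right').lintegral_prod_right'

lemma DD_measurable {n d : ℕ} (f : EE n → EE d) (hf : Continuous f) : Measurable (DD f) := by
  have hc := continuous_sdiff2 hf
  unfold DD
  exact ((hc.comp continuous_swap).enorm.measurable.pow_const 2).lintegral_prod_right'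

lemma WW_sum_ae_cs {n d : ℕ} (f : EE n → EE d) (K : ℝ≥0) (hf : LipschitzWith K f) (ρ : ℝ)
    (hs : ∀ w, w ∉ ball (0 : EE n) ρ → f w = 0) (a : ℝ) :
    ∀ᵐ z : EE n, ∑' j : ℕ, (4 : ℝ≥0∞) ^ j * WW f z (a * (2:ℝ)⁻¹ ^ j) < ⊤ := by
  have hm := fun j : ℕ => (WW_measurable f hf.continuous (a * (2:ℝ)⁻¹ ^ j)).const_mul ((4:ℝ≥0∞)^j)
  refine ae_lt_top (Measurable.tsum hm) (ne_of_lt ?_)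
  rw [lintegral_tsum (fun j => (hm j).aemeasurable)]
  have e1 : ∀ j : ℕ, ∫⁻ z, (4 : ℝ≥0∞) ^ j * WW f z (a * (2:ℝ)⁻¹ ^ j) =
      volume (ball (0 : EE n) 2) * (4 ^ j * ∫⁻ k in ball (0 : EE n) 2, DD f ((a * (2:ℝ)⁻¹ ^ j) • k)) := by
    intro j
    rw [lintegral_const_mul _ (WW_measurable f hf.continuous _), WW_integral f hf.continuous,
      mul_left_comm]
  simp_rw [e1]
  rw [ENNReal.tsum_mul_left]
  refine ENNReal.mul_lt_top measure_ball_lt_top ?_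
  have hm2 : ∀ j : ℕ, Measurable (fun k : EE n => DD f ((a * (2:ℝ)⁻¹ ^ j) • k)) := fun j =>
    (DD_measurable f hf.continuous).comp (by fun_prop)
  have e2 : ∀ j : ℕ, (4 : ℝ≥0∞) ^ j * ∫⁻ k in ball (0 : EE n) 2, DD f ((a * (2:ℝ)⁻¹ ^ j) • k) =
      ∫⁻ k in ball (0 : EE n) 2, 4 ^ j * DD f ((a * (2:ℝ)⁻¹ ^ j) • k) := fun j =>
    (lintegral_const_mul _ (hm2 j)).symm
  simp_rw [e2]
  rw [← lintegral_tsum (fun j => ((hm2 j).const_mul _).aemeasurable)]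
  have : ∀ k ∈ ball (0 : EE n) 2, ∑' j : ℕ, (4 : ℝ≥0∞) ^ j * DD f ((a * (2:ℝ)⁻¹ ^ j) • k) ≤
     4 * ((2 * K ^ 2 * volume (ball (0 : EE n) ρ)) * (‖a‖ₑ * 2) ^ 2) := by
    intro k hk
    have e : ∀ j : ℕ, (a * (2:ℝ)⁻¹ ^ j) • k = ((2:ℝ)⁻¹ ^ j) • (a • k) := fun j => by
      rw [smul_smul, mul_comm]
    simp_rw [e]
    refine (DD_sum_le f K hf ρ hs (a • k)).trans ?_
    gcongr
    rw [enorm_smul]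
    gcongr
    rw [mem_ball_zero_iff] at hk
    rw [← ofReal_norm]
    exact (ENNReal.ofReal_le_ofReal hk.le).trans (by simp)
  refine (setLIntegral_mono measurable_const this).trans_lt ?_
  rw [setLIntegral_const]
  have := measure_ball_lt_top (μ := volume) (x := (0 : EE n)) (r := ρ)
  have := measure_ball_lt_top (μ := volume) (x := (0 : EE n)) (r := 2)
  finiteness

/-- cut-off of a Lipschitz function -/
lemma cutoff_lip {n d : ℕ} (f : EE n → EE d) (K : ℝ≥0) (hf : LipschitzWith K f) (ρ : ℝ) (hρ : 0 < ρ) :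
    ∃ (g : EE n → EE d) (K' : ℝ≥0), LipschitzWith K' g ∧ (∀ w ∈ ball (0 : EE n) ρ, g w = f w) ∧
      ∀ w, w ∉ ball (0 : EE n) (ρ + 1) → g w = 0 := by
  set η : EE n → ℝ := fun w => max 0 (min 1 (ρ + 1 - ‖w‖)) with hη
  have hη0 : ∀ w, 0 ≤ η w := fun w => le_max_left _ _
  have hη1 : ∀ w, η w ≤ 1 := fun w => max_le zero_le_one (min_le_left _ _)
  have hηL : ∀ v w, |η v - η w| ≤ ‖v - w‖ := by
    intro v w
    have h1 : |η v - η w| ≤ |(min 1 (ρ + 1 - ‖v‖)) - (min 1 (ρ + 1 - ‖w‖))| :=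
      (abs_max_sub_max_le_max _ _ _ _).trans (by simp)
    have h2 : |(min 1 (ρ + 1 - ‖v‖)) - (min 1 (ρ + 1 - ‖w‖))| ≤ |(ρ + 1 - ‖v‖) - (ρ + 1 - ‖w‖)| :=
      (abs_min_sub_min_le_max _ _ _ _).trans (by simp)
    refine h1.trans (h2.trans ?_)
    rw [show (ρ + 1 - ‖v‖) - (ρ + 1 - ‖w‖) = ‖w‖ - ‖v‖ by ring, norm_sub_rev]
    exact abs_norm_sub_norm_le w v
  have hηs : ∀ w, η w ≠ 0 → ‖w‖ < ρ + 1 := by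
    intro w hw
    by_contra h
    push Not at h
    apply hw
    simp only [hη]
    exact max_eq_left (min_le_right _ _ |>.trans (by linarith))
  set B : ℝ := ‖f 0‖ + K * (ρ + 1) with hB
  have hB0 : 0 ≤ B := by positivity
  have hfB : ∀ w, ‖w‖ < ρ + 1 → ‖f w‖ ≤ B := by
    intro w hw
    have h := hf.dist_le_mul w 0
    rw [dist_eq_norm, dist_zero_right] at h
    have h2 : ‖f w‖ ≤ ‖f 0‖ + ‖f w - f 0‖ := by
      simpa using norm_add_le (f 0) (f w - f 0)
    have : (K:ℝ) * ‖w‖ ≤ K * (ρ + 1) := by gcongr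
    linarith
  refine ⟨fun w => η w • f w, Real.toNNReal (B + K), ?_, ?_, ?_⟩
  · refine LipschitzWith.of_dist_le_mul fun v w => ?_
    rw [Real.coe_toNNReal _ (by positivity), dist_eq_norm, dist_eq_norm]
    by_cases hv : η v = 0
    · by_cases hw : η w = 0
      · simp only [hv, hw, zero_smul, sub_zero, norm_zero]; positivity
      · have h1 := hηL v w
        rw [hv, zero_sub, abs_neg] at h1
        simp only [hv, zero_smul, zero_sub, norm_neg, norm_smul, Real.norm_eq_abs]
        have h2 := hfB w (hηs w hw)
        calc |η w| * ‖f w‖ ≤ ‖v - w‖ * B := by gcongr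
          _ ≤ (B + K) * ‖v - w‖ := by nlinarith [norm_nonneg (v - w), K.coe_nonneg]
    · have h2 := hfB v (hηs v hv)
      have h3 : η v • f v - η w • f w = (η v - η w) • f v + η w • (f v - f w) := by
        rw [sub_smul, smul_sub]; abel
      rw [h3]
      refine (norm_add_le _ _).trans ?_
      rw [norm_smul, norm_smul, Real.norm_eq_abs, Real.norm_eq_abs, abs_of_nonneg (hη0 w)]
      have h4 := hf.dist_le_mul v w
      rw [dist_eq_norm, dist_eq_norm] at h4
      calc |η v - η w| * ‖f v‖ + η w * ‖f v - f w‖ ≤ ‖v - w‖ * B + 1 * (K * ‖v - w‖) := by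
            gcongr
            · exact hηL v w
            · exact hη1 w
        _ = _ := by ring
  · intro w hw
    rw [mem_ball_zero_iff] at hw
    have : η w = 1 := by
      simp only [hη]
      rw [min_eq_left (by linarith), max_eq_right zero_le_one]
    simp [this]
  · intro w hw
    rw [mem_ball_zero_iff] at hw
    have : η w = 0 := by
      by_contra h
      exact hw (hηs w h)
    simp [this]

lemma WW_sum_ae {n d : ℕ} (f : EE n → EE d) (K : ℝ≥0) (hf : LipschitzWith K f) (a : ℝ) (ha : 0 < a) :
    ∀ᵐ z : EE n, ∑' j : ℕ, (4 : ℝ≥0∞) ^ j * WW f z (a * (2:ℝ)⁻¹ ^ j) < ⊤ := by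
  have h : ∀ N : ℕ, ∀ᵐ z : EE n, z ∈ ball (0 : EE n) N →
      ∑' j : ℕ, (4 : ℝ≥0∞) ^ j * WW f z (a * (2:ℝ)⁻¹ ^ j) < ⊤ := by
    intro N
    obtain ⟨g, K', hg, hgf, hgs⟩ := cutoff_lip f K hf (N + 4 * a) (by positivity)
    filter_upwards [WW_sum_ae_cs g K' hg _ hgs a] with z hz hzN
    have : ∀ j : ℕ, WW f z (a * (2:ℝ)⁻¹ ^ j) = WW g z (a * (2:ℝ)⁻¹ ^ j) := by
      intro j
      set ρ := a * (2:ℝ)⁻¹ ^ j with hρ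
      have hρ0 : 0 < ρ := by positivity
      have hρa : ρ ≤ a := by
        have : (2:ℝ)⁻¹ ^ j ≤ 1 := pow_le_one₀ (by norm_num) (by norm_num)
        nlinarith
      unfold WW
      refine setLIntegral_congr_fun measurableSet_ball fun k hk => ?_
      refine setLIntegral_congr_fun measurableSet_ball fun w hw => ?_
      rw [mem_ball_zero_iff] at hk hw hzN
      have e1 : ‖ρ • w‖ ≤ 2 * a := by
        rw [norm_smul, Real.norm_of_nonneg hρ0.le]; nlinarith [norm_nonneg w]
      have e2 : ‖ρ • k‖ ≤ 2 * a := by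
        rw [norm_smul, Real.norm_of_nonneg hρ0.le]; nlinarith [norm_nonneg k]
      have hb : ∀ v : EE n, ‖v‖ ≤ 2 * a → g (z + ρ • w + v) = f (z + ρ • w + v) := by
        intro v hv
        apply hgf
        rw [mem_ball_zero_iff]
        have := norm_add_le (z + ρ • w) v
        have := norm_add_le z (ρ • w)
        linarith
      simp only [sdiff2]
      have b1 := hb _ e2
      have b2 := hb (-(ρ • k)) (by rwa [norm_neg])
      have b3 := hb 0 (by simp; positivity)
      rw [← sub_eq_add_neg] at b2
      rw [add_zero] at b3
      rw [b1, b2, b3]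
    simp_rw [this]
    exact hz
  rw [← ae_all_iff] at h
  filter_upwards [h] with z hz
  obtain ⟨N, hN⟩ := exists_nat_gt ‖z‖
  exact hz N (by simpa using hN)

lemma lintegral_sq_le {α : Type*} [MeasurableSpace α] (m : Measure α) (F : α → ℝ≥0∞)
    (hF : AEMeasurable F m) : (∫⁻ x, F x ∂m) ^ 2 ≤ m univ * ∫⁻ x, F x ^ 2 ∂m := by
  have h := ENNReal.lintegral_mul_le_Lp_mul_Lq m (p := 2) (q := 2) Real.HolderConjugate.two_two
    hF (g := 1) aemeasurable_const
  simp only [Pi.mul_apply, Pi.one_apply, mul_one, ENNReal.one_rpow, lintegral_const, one_mul] at h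
  have h2 := pow_le_pow_left' h 2
  refine h2.trans (le_of_eq ?_)
  rw [mul_pow, ← ENNReal.rpow_natCast, ← ENNReal.rpow_natCast, ← ENNReal.rpow_mul,
    ← ENNReal.rpow_mul]
  norm_num
  rw [mul_comm]

lemma exists_bump (n : ℕ) : ∃ (φ : EE n → ℝ) (c : ℝ≥0), ContDiff ℝ 1 φ ∧ HasCompactSupport φ ∧
    (∀ x, φ (-x) = φ x) ∧ ∫ x, φ x = 1 ∧ (∀ x, x ∉ ball (0 : EE n) 1 → φ x = 0) ∧
    (∀ x, x ∉ ball (0 : EE n) 1 → fderiv ℝ φ x = 0) ∧ (∀ x, ‖φ x‖ ≤ c) ∧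
    ∀ x, ‖fderiv ℝ φ x‖ ≤ c := by
  let b : ContDiffBump (0 : EE n) := ⟨1/4, 1/2, by norm_num, by norm_num⟩
  have hc : ContDiff ℝ 1 (b.normed volume) := b.contDiff_normed (n := 1)
  have hs : HasCompactSupport (b.normed volume) := b.hasCompactSupport_normed
  obtain ⟨c1, hc1⟩ := hs.exists_bound_of_continuous hc.continuous
  obtain ⟨c2, hc2⟩ := (hs.fderiv ℝ).exists_bound_of_continuous (hc.continuous_fderiv one_ne_zero)
  have hb : ∀ x, x ∉ ball (0 : EE n) 1 → x ∉ tsupport (b.normed volume) := by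
    intro x hx
    rw [b.tsupport_normed_eq]
    rw [mem_ball_zero_iff] at hx
    rw [mem_closedBall_zero_iff]
    intro h
    have : b.rOut = 1/2 := rfl
    rw [this] at h
    linarith
  refine ⟨b.normed volume, Real.toNNReal (max c1 c2), hc, hs, b.normed_neg, b.integral_normed, ?_, ?_,
    ?_, ?_⟩
  · exact fun x hx => image_eq_zero_of_notMem_tsupport (hb x hx)
  · intro x hx
    have := hb x hx
    exact image_eq_zero_of_notMem_tsupport (fun h => this (tsupport_fderiv_subset ℝ h))
  · exact fun x => ((hc1 x).trans (le_max_left _ _)).trans (Real.le_coe_toNNReal _)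
  · exact fun x => ((hc2 x).trans (le_max_right _ _)).trans (Real.le_coe_toNNReal _)

/-- basic bound -/
lemma enorm_integral_smul_le {n d : ℕ} (ψ : EE n → ℝ) (C : ℝ≥0∞) (h0 : ∀ x, x ∉ ball (0 : EE n) 1 → ψ x = 0)
    (hC : ∀ x, ‖ψ x‖ₑ ≤ C) (F : EE n → EE d) (hCt : C ≠ ⊤) :
    ‖∫ w, ψ w • F w‖ₑ ≤ C * ∫⁻ w in ball (0 : EE n) 1, ‖F w‖ₑ := by
  refine (enorm_integral_le_lintegral_enorm _).trans ?_
  rw [← lintegral_const_mul' _ _ hCt, ← lintegral_indicator measurableSet_ball]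
  refine lintegral_mono fun w => ?_
  by_cases hw : w ∈ ball (0 : EE n) 1
  · rw [indicator_of_mem hw, enorm_smul]
    gcongr
    exact hC w
  · rw [h0 w hw]; simp

lemma setLIntegral_shift_le {n : ℕ} (F : EE n → ℝ≥0∞) (u : EE n) (hu : ‖u‖ ≤ 1) :
    ∫⁻ w in ball (0 : EE n) 1, F (u - w) ≤ ∫⁻ w in ball (0 : EE n) 2, F w := by
  rw [← lintegral_indicator measurableSet_ball, ← lintegral_indicator measurableSet_ball,
    ← lintegral_sub_left_eq_self (μ := volume) ((ball (0 : EE n) 2).indicator fun w => F w) u]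
  refine lintegral_mono fun w => ?_
  by_cases hw : w ∈ ball (0 : EE n) 1
  · have : u - w ∈ ball (0 : EE n) 2 := by
      rw [mem_ball_zero_iff] at *
      linarith [norm_sub_le u w]
    rw [indicator_of_mem hw, indicator_of_mem this]
  · simp [hw]

lemma setLIntegral_shift_le' {n : ℕ} (F : EE n → ℝ≥0∞) (u : EE n) (hu : ‖u‖ ≤ 1) :
    ∫⁻ w in ball (0 : EE n) 1, F (u + w) ≤ ∫⁻ w in ball (0 : EE n) 2, F w := by
  rw [← lintegral_indicator measurableSet_ball, ← lintegral_indicator measurableSet_ball,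
    ← lintegral_add_left_eq_self (μ := volume) ((ball (0 : EE n) 2).indicator fun w => F w) u]
  refine lintegral_mono fun w => ?_
  by_cases hw : w ∈ ball (0 : EE n) 1
  · have : u + w ∈ ball (0 : EE n) 2 := by
      rw [mem_ball_zero_iff] at *
      linarith [norm_add_le u w]
    rw [indicator_of_mem hw, indicator_of_mem this]
  · simp [hw]

/-- mollification -/
def moll {n d : ℕ} (φ : EE n → ℝ) (g : EE n → EE d) (u : EE n) : EE d := ∫ w, φ w • g (u - w)

section moll
variable {n d : ℕ} {φ : EE n → ℝ} {g : EE n → EE d}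

lemma moll_integrable (hφ : Continuous φ) (hs : HasCompactSupport φ) {F : EE n → EE d} (hF : Continuous F) :
    Integrable (fun w => φ w • F w) :=
  (hφ.smul hF).integrable_of_hasCompactSupport hs.smul_right

lemma moll_eq_conv : moll φ g = convolution φ g (ContinuousLinearMap.lsmul ℝ ℝ) volume := by
  ext1 u
  rfl

lemma moll_continuous (hφ : Continuous φ) (hs : HasCompactSupport φ) (hg : Continuous g) :
    Continuous (moll φ g) := by
  rw [moll_eq_conv]
  exact hs.continuous_convolution_left _ hφ hg.locallyIntegrable

lemma sdiff2_moll (hφ : Continuous φ) (hs : HasCompactSupport φ) (hg : Continuous g) (u k : EE n) :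
    sdiff2 (moll φ g) u k = ∫ w, φ w • sdiff2 g (u - w) k := by
  unfold sdiff2 moll
  rw [← integral_smul, ← integral_add, ← integral_sub]
  · congr 1; ext1 w
    rw [smul_sub, smul_add, smul_comm, show u + k - w = u - w + k by abel,
      show u - k - w = u - w - k by abel]
  · exact (moll_integrable hφ hs (by fun_prop)).add (moll_integrable hφ hs (by fun_prop))
  · exact (moll_integrable (F := fun w => g (u - w)) hφ hs (by fun_prop)).smul (2:ℝ)
  · exact (moll_integrable hφ hs (by fun_prop))
  · exact (moll_integrable hφ hs (by fun_prop))

lemma moll_sub (hφ : Continuous φ) (hs : HasCompactSupport φ) (hg : Continuous g)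
    (heven : ∀ x, φ (-x) = φ x) (h1 : ∫ x, φ x = 1) (u : EE n) :
    (2:ℝ) • (moll φ g u - g u) = ∫ w, φ w • sdiff2 g u w := by
  have e1 : moll φ g u = ∫ w, φ w • g (u + w) := by
    unfold moll
    rw [← integral_neg_eq_self]
    simp [heven]
  have e2 : g u = ∫ w, φ w • g u := by rw [integral_smul_const, h1, one_smul]
  have e3 : (2:ℝ) • (moll φ g u - g u) = moll φ g u + moll φ g u - (2:ℝ) • g u := by
    rw [smul_sub, two_smul]
  rw [e3]
  nth_rw 1 [e1]
  rw [show (2:ℝ) • g u = (2:ℝ) • ∫ w, φ w • g u by rw [← e2]]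
  unfold moll sdiff2
  rw [← integral_smul, ← integral_add, ← integral_sub]
  · congr 1; ext1 w
    rw [smul_sub, smul_add, smul_comm]
  · exact (moll_integrable hφ hs (by fun_prop)).add (moll_integrable hφ hs (by fun_prop))
  · exact (moll_integrable (F := fun w => g u) hφ hs (by fun_prop)).smul (2:ℝ)
  · exact (moll_integrable hφ hs (by fun_prop))
  · exact (moll_integrable hφ hs (by fun_prop))

lemma enorm_le_two_smul (y : EE d) : ‖y‖ₑ ≤ ‖(2:ℝ) • y‖ₑ := by
  rw [← ofReal_norm, ← ofReal_norm, norm_smul]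
  apply ENNReal.ofReal_le_ofReal
  simp; linarith [norm_nonneg y]

lemma moll_sub_le (c : ℝ≥0) (hφ : Continuous φ) (hs : HasCompactSupport φ) (hg : Continuous g)
    (heven : ∀ x, φ (-x) = φ x) (h1 : ∫ x, φ x = 1)
    (h0 : ∀ x, x ∉ ball (0 : EE n) 1 → φ x = 0) (hc : ∀ x, ‖φ x‖ ≤ c) (u : EE n) :
    ‖moll φ g u - g u‖ₑ ≤ c * ∫⁻ w in ball (0 : EE n) 1, ‖sdiff2 g u w‖ₑ := by
  refine (enorm_le_two_smul _).trans ?_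
  rw [moll_sub hφ hs hg heven h1]
  exact enorm_integral_smul_le φ c h0 (fun x => by exact_mod_cast hc x) _ (by simp)

lemma sdiff2_moll_le (c : ℝ≥0) (hφ : Continuous φ) (hs : HasCompactSupport φ) (hg : Continuous g)
    (h0 : ∀ x, x ∉ ball (0 : EE n) 1 → φ x = 0) (hc : ∀ x, ‖φ x‖ ≤ c) (u k : EE n) (hu : ‖u‖ ≤ 1) :
    ‖sdiff2 (moll φ g) u k‖ₑ ≤ c * ∫⁻ w in ball (0 : EE n) 2, ‖sdiff2 g w k‖ₑ := by
  rw [sdiff2_moll hφ hs hg]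
  refine (enorm_integral_smul_le φ c h0 (fun x => by exact_mod_cast hc x) _ (by simp)).trans ?_
  refine mul_le_mul' le_rfl ?_
  exact setLIntegral_shift_le (fun w => ‖sdiff2 g w k‖ₑ) u hu

lemma moll_hasFDerivAt (hφ : ContDiff ℝ 1 φ) (hs : HasCompactSupport φ) (hg : Continuous g) (u : EE n) :
    ∃ T : EE n →L[ℝ] EE d, HasFDerivAt (moll φ g) T u ∧
      ∀ x, T x = ∫ w, (fderiv ℝ φ w x) • g (u - w) := by
  refine ⟨_, by rw [moll_eq_conv]; exact hs.hasFDerivAt_convolution_left _ hφ hg.locallyIntegrable u, ?_⟩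
  intro x
  rw [convolution_def, ContinuousLinearMap.integral_apply]
  · rfl
  · exact (hs.fderiv ℝ).convolutionExists_left _ (hφ.continuous_fderiv one_ne_zero)
      hg.locallyIntegrable u

lemma fderiv_odd (hφ : ContDiff ℝ 1 φ) (heven : ∀ x, φ (-x) = φ x) (k x : EE n) :
    fderiv ℝ φ (-k) x = - fderiv ℝ φ k x := by
  have h1 : HasFDerivAt φ (fderiv ℝ φ (-k)) (-k) :=
    (hφ.differentiable one_ne_zero).differentiableAt.hasFDerivAt
  have h2 : HasFDerivAt (fun x : EE n => -x) (-(ContinuousLinearMap.id ℝ (EE n))) k :=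
    (hasFDerivAt_id k).neg
  have h3 := h1.comp k h2
  have h4 : φ ∘ (fun x : EE n => -x) = φ := by ext x; exact heven x
  rw [h4] at h3
  rw [h3.fderiv]
  simp

lemma moll_fderiv_sub (c : ℝ≥0) (hφ : ContDiff ℝ 1 φ) (hs : HasCompactSupport φ) (hg : Continuous g)
    (heven : ∀ x, φ (-x) = φ x)
    (h0 : ∀ x, x ∉ ball (0 : EE n) 1 → φ x = 0)
    (h0' : ∀ x, x ∉ ball (0 : EE n) 1 → fderiv ℝ φ x = 0) (hc : ∀ x, ‖φ x‖ ≤ c)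
    (hc' : ∀ x, ‖fderiv ℝ φ x‖ ≤ c) (v : EE n) (hv : ‖v‖ ≤ 1) (x : EE n) :
    ‖(∫ k, (fderiv ℝ φ k x) • moll φ g (v - k)) - ∫ k, (fderiv ℝ φ k x) • moll φ g (0 - k)‖ₑ ≤
      c ^ 2 * (∫⁻ k in ball (0 : EE n) 2, ∫⁻ w in ball (0 : EE n) 2, ‖sdiff2 g w k‖ₑ) * ‖x‖ₑ := by
  set ψ : EE n → ℝ := fun k => fderiv ℝ φ k x with hψ
  set I := ∫⁻ k in ball (0 : EE n) 2, ∫⁻ w in ball (0 : EE n) 2, ‖sdiff2 g w k‖ₑ with hI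
  have hψc : Continuous ψ := (hφ.continuous_fderiv one_ne_zero).clm_apply continuous_const
  have hψs : HasCompactSupport ψ := by
    refine (hs.fderiv ℝ).mono ?_
    intro k hk hk2
    exact hk (by simp only [hψ]; rw [hk2]; simp)
  have hm : Continuous (moll φ g) := moll_continuous hφ.continuous hs hg
  have hodd : ∀ F : EE n → EE d, ∫ k, ψ k • F (-k) = - ∫ k, ψ k • F k := by
    intro F
    rw [← integral_neg_eq_self, ← integral_neg]
    congr 1; ext1 k
    simp only [hψ, neg_neg, fderiv_odd hφ heven, neg_smul]
  have hintg : ∀ F : EE n → EE d, Continuous F → Integrable (fun w => ψ w • F w) :=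
    fun F hF => moll_integrable hψc hψs hF
  have e : (2:ℝ) • ((∫ k, ψ k • moll φ g (v - k)) - ∫ k, ψ k • moll φ g (0 - k)) =
      (∫ k, ψ k • sdiff2 (moll φ g) ((2:ℝ)⁻¹ • v) ((2:ℝ)⁻¹ • v - k)) -
        ∫ k, ψ k • sdiff2 (moll φ g) ((2:ℝ)⁻¹ • v) ((2:ℝ)⁻¹ • v + k) := by
    have o1 := hodd (fun k => moll φ g (v + k))
    have o2 := hodd (fun k => moll φ g (0 + k))
    simp only [← sub_eq_add_neg] at o1 o2
    have hv2 : (2:ℝ)⁻¹ • v + (2:ℝ)⁻¹ • v = v := by rw [← add_smul]; norm_num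
    have e1 : ∀ k, sdiff2 (moll φ g) ((2:ℝ)⁻¹ • v) ((2:ℝ)⁻¹ • v - k) =
        moll φ g (v - k) + moll φ g (0 + k) - (2:ℝ) • moll φ g ((2:ℝ)⁻¹ • v) := by
      intro k
      unfold sdiff2
      rw [← add_sub_assoc, hv2, sub_sub_cancel, zero_add]
    have e2 : ∀ k, sdiff2 (moll φ g) ((2:ℝ)⁻¹ • v) ((2:ℝ)⁻¹ • v + k) =
        moll φ g (v + k) + moll φ g (0 - k) - (2:ℝ) • moll φ g ((2:ℝ)⁻¹ • v) := by
      intro k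
      unfold sdiff2
      rw [← add_assoc, hv2, sub_add_cancel_left, zero_sub]
    simp only [e1, e2, smul_sub, smul_add]
    have i1 : Integrable (fun k => ψ k • moll φ g (v - k)) := hintg _ (by fun_prop)
    have i2 : Integrable (fun k => ψ k • moll φ g (v + k)) := hintg _ (by fun_prop)
    have i3 : Integrable (fun k => ψ k • moll φ g (0 - k)) := hintg _ (by fun_prop)
    have i4 : Integrable (fun k => ψ k • moll φ g (0 + k)) := hintg _ (by fun_prop)
    have i5 : Integrable (fun k => ψ k • (2:ℝ) • moll φ g ((2:ℝ)⁻¹ • v)) := hintg _ (by fun_prop)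
    have i14 : Integrable (fun k => ψ k • moll φ g (v - k) + ψ k • moll φ g (0 + k)) := i1.add i4
    have i23 : Integrable (fun k => ψ k • moll φ g (v + k) + ψ k • moll φ g (0 - k)) := i2.add i3
    rw [integral_sub i14 i5, integral_sub i23 i5, integral_add i1 i4,
      integral_add i2 i3]
    have o4 : ∫ k, ψ k • moll φ g (v + k) = - ∫ k, ψ k • moll φ g (v - k) := by rw [o1, neg_neg]
    have o5 : ∫ k, ψ k • moll φ g (0 + k) = - ∫ k, ψ k • moll φ g (0 - k) := by rw [o2, neg_neg]
    rw [o4, o5, two_smul, two_smul]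
    abel
  have hhalf : ‖(2:ℝ)⁻¹ • v‖ ≤ 1 := by
    rw [norm_smul]; norm_num; linarith
  have hψb : ∀ k, ‖ψ k‖ₑ ≤ c * ‖x‖ₑ := by
    intro k
    refine ((fderiv ℝ φ k).le_opENorm x).trans ?_
    gcongr
    exact_mod_cast hc' k
  have hψ0 : ∀ k, k ∉ ball (0 : EE n) 1 → ψ k = 0 := by
    intro k hk; simp only [hψ]; rw [h0' k hk]; simp
  have htop : (c:ℝ≥0∞) * ‖x‖ₑ ≠ ⊤ := ENNReal.mul_ne_top (by simp) (by simp)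
  have b1 : ‖∫ k, ψ k • sdiff2 (moll φ g) ((2:ℝ)⁻¹ • v) ((2:ℝ)⁻¹ • v - k)‖ₑ ≤ c ^ 2 * I * ‖x‖ₑ := by
    refine (enorm_integral_smul_le ψ (c * ‖x‖ₑ) hψ0 hψb _ htop).trans ?_
    calc _ ≤ (c:ℝ≥0∞) * ‖x‖ₑ * ∫⁻ k in ball (0 : EE n) 1, c * ∫⁻ w in ball (0 : EE n) 2, ‖sdiff2 g w ((2:ℝ)⁻¹ • v - k)‖ₑ := by
          refine mul_le_mul' le_rfl (lintegral_mono fun k => ?_)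
          exact sdiff2_moll_le c hφ.continuous hs hg h0 hc _ _ hhalf
      _ ≤ (c:ℝ≥0∞) * ‖x‖ₑ * (c * I) := by
          rw [lintegral_const_mul' _ _ (by simp)]
          refine mul_le_mul' le_rfl (mul_le_mul' le_rfl ?_)
          exact setLIntegral_shift_le (fun k => ∫⁻ w in ball (0 : EE n) 2, ‖sdiff2 g w k‖ₑ) _ hhalf
      _ = _ := by ring
  have b2 : ‖∫ k, ψ k • sdiff2 (moll φ g) ((2:ℝ)⁻¹ • v) ((2:ℝ)⁻¹ • v + k)‖ₑ ≤ c ^ 2 * I * ‖x‖ₑ := by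
    refine (enorm_integral_smul_le ψ (c * ‖x‖ₑ) hψ0 hψb _ htop).trans ?_
    calc _ ≤ (c:ℝ≥0∞) * ‖x‖ₑ * ∫⁻ k in ball (0 : EE n) 1, c * ∫⁻ w in ball (0 : EE n) 2, ‖sdiff2 g w ((2:ℝ)⁻¹ • v + k)‖ₑ := by
          refine mul_le_mul' le_rfl (lintegral_mono fun k => ?_)
          exact sdiff2_moll_le c hφ.continuous hs hg h0 hc _ _ hhalf
      _ ≤ (c:ℝ≥0∞) * ‖x‖ₑ * (c * I) := by
          rw [lintegral_const_mul' _ _ (by simp)]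
          refine mul_le_mul' le_rfl (mul_le_mul' le_rfl ?_)
          exact setLIntegral_shift_le' (fun k => ∫⁻ w in ball (0 : EE n) 2, ‖sdiff2 g w k‖ₑ) _ hhalf
      _ = _ := by ring
  have b3 : ‖(2:ℝ) • ((∫ k, ψ k • moll φ g (v - k)) - ∫ k, ψ k • moll φ g (0 - k))‖ₑ ≤
      2 * (c ^ 2 * I * ‖x‖ₑ) := by
    rw [e, two_mul]
    exact (enorm_sub_le).trans (add_le_add b1 b2)
  rw [enorm_smul] at b3
  have : ‖(2:ℝ)‖ₑ = 2 := by rw [← ofReal_norm]; norm_num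
  rw [this] at b3
  exact (ENNReal.mul_le_mul_iff_right (by simp) (by simp)).mp b3

end moll

lemma continuous_sdiff2_swap {n d : ℕ} {g : EE n → EE d} (hg : Continuous g) :
    Continuous (fun p : EE n × EE n => sdiff2 g p.1 p.2) := by
  unfold sdiff2; fun_prop

lemma add_sq_le_enn (a b : ℝ≥0∞) : (a + b) ^ 2 ≤ 2 * (a ^ 2 + b ^ 2) := by
  rcases eq_or_ne a ⊤ with rfl | ha
  · simp
  rcases eq_or_ne b ⊤ with rfl | hb
  · simp
  lift a to ℝ≥0 using ha
  lift b to ℝ≥0 using hb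
  norm_cast
  rw [← NNReal.coe_le_coe]
  push_cast
  nlinarith [sq_nonneg ((a:ℝ) - b)]

lemma moll_bound {n d : ℕ} (ψ : EE n → ℝ) (C ε : ℝ≥0) (R : ℝ) (h0 : ∀ x, x ∉ ball (0 : EE n) 1 → ψ x = 0)
    (hC : ∀ x, ‖ψ x‖ ≤ C) (F : EE n → EE d) (u : EE n) (hu : ‖u‖ ≤ R)
    (hF : ∀ w, ‖w‖ ≤ R + 1 → ‖F w‖ ≤ ε) :
    ‖∫ w, ψ w • F (u - w)‖ₑ ≤ C * ε * volume (ball (0 : EE n) 1) := by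
  refine (enorm_integral_smul_le ψ C h0 (fun x => by exact_mod_cast hC x) _ (by simp)).trans ?_
  rw [mul_assoc]
  refine mul_le_mul' le_rfl ?_
  rw [← setLIntegral_const]
  refine setLIntegral_mono measurable_const fun w hw => ?_
  rw [mem_ball_zero_iff] at hw
  have := hF (u - w) (by linarith [norm_sub_le u w])
  exact_mod_cast this

lemma whitney (n d : ℕ) : ∃ C : ℝ≥0, ∀ (g : EE n → EE d), Continuous g → ∀ ε : ℝ≥0,
    (∀ u : EE n, ‖u‖ ≤ 2 → ‖g u‖ ≤ ε) →
    ∃ (a : EE d) (T : EE n →L[ℝ] EE d), ‖a‖ ≤ C * ε ∧ ‖T‖ ≤ C * ε ∧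
      ∫⁻ u in ball (0 : EE n) 1, ‖g u - (a + T u)‖ₑ ^ 2 ≤
        C * ∫⁻ k in ball (0 : EE n) 2, ∫⁻ w in ball (0 : EE n) 2, ‖sdiff2 g w k‖ₑ ^ 2 := by
  obtain ⟨φ, c, hφ, hs, heven, h1, h0, h0', hc, hc'⟩ := exists_bump n
  set V1 : ℝ≥0∞ := volume (ball (0 : EE n) 1) with hV1
  set V : ℝ≥0∞ := volume (ball (0 : EE n) 2) with hV
  have hV1t : V1 ≠ ⊤ := measure_ball_lt_top.ne
  have hVt : V ≠ ⊤ := measure_ball_lt_top.ne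
  have hV1V : V1 ≤ V := measure_mono (ball_subset_ball (by norm_num))
  set v1 : ℝ≥0 := V1.toNNReal with hv1
  have hv1c : (v1 : ℝ≥0∞) = V1 := ENNReal.coe_toNNReal hV1t
  set v : ℝ≥0 := V.toNNReal with hv
  have hvc : (v : ℝ≥0∞) = V := ENNReal.coe_toNNReal hVt
  set C1 : ℝ≥0 := (c * v1) ^ 2 with hC1d
  set C2 : ℝ≥0 := 2 * c ^ 2 * v + 8 * c ^ 4 * v ^ 3 with hC2
  refine ⟨max C1 C2, fun g hg ε hε => ?_⟩
  set g1 := moll φ g with hg1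
  set g2 := moll φ g1 with hg2
  have hg1c : Continuous g1 := moll_continuous hφ.continuous hs hg
  have key := fun u => moll_hasFDerivAt (g := g1) hφ hs hg1c u
  choose D hD hDx using key
  have hg1b : ∀ u : EE n, ‖u‖ ≤ 1 → ‖g1 u‖ ≤ ((c * v1 * ε : ℝ≥0) : ℝ) := by
    intro u hu
    have := moll_bound φ c ε 1 h0 hc g u hu (fun w hw => hε w (by linarith))
    rw [← hV1, ← hv1c] at this
    have h : ‖g1 u‖ₑ ≤ ((c * v1 * ε : ℝ≥0) : ℝ≥0∞) := by
      refine this.trans (le_of_eq ?_)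
      push_cast; ring
    exact_mod_cast h
  have hC1 : C1 * ε ≤ max C1 C2 * ε := by gcongr; exact le_max_left _ _
  set I := ∫⁻ k in ball (0 : EE n) 2, ∫⁻ w in ball (0 : EE n) 2, ‖sdiff2 g w k‖ₑ with hI
  set Q := ∫⁻ k in ball (0 : EE n) 2, ∫⁻ w in ball (0 : EE n) 2, ‖sdiff2 g w k‖ₑ ^ 2 with hQ
  have hsc : Continuous (fun p : EE n × EE n => sdiff2 g p.1 p.2) := continuous_sdiff2_swap hg
  have hIm : ∀ k, Measurable fun w => ‖sdiff2 g w k‖ₑ := fun k =>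
    (hsc.comp (by fun_prop : Continuous fun w : EE n => (w, k))).enorm.measurable
  have hIm' : ∀ w, Measurable fun k => ‖sdiff2 g w k‖ₑ := fun w =>
    (hsc.comp (by fun_prop : Continuous fun k : EE n => (w, k))).enorm.measurable
  have hIQ : I ^ 2 ≤ V ^ 2 * Q := by
    have hJ : Measurable fun k => ∫⁻ w in ball (0 : EE n) 2, ‖sdiff2 g w k‖ₑ := by
      refine Measurable.lintegral_prod_right' (f := fun p : EE n × EE n => ‖sdiff2 g p.2 p.1‖ₑ) ?_
      exact (hsc.comp (by fun_prop : Continuous fun p : EE n × EE n => (p.2, p.1))).enorm.measurable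
    refine (lintegral_sq_le _ _ hJ.aemeasurable).trans ?_
    rw [Measure.restrict_apply_univ, ← hV, pow_two, mul_assoc]
    refine mul_le_mul' le_rfl ?_
    rw [hQ, ← lintegral_const_mul' _ _ hVt]
    refine lintegral_mono fun k => ?_
    refine (lintegral_sq_le _ _ (hIm k).aemeasurable).trans ?_
    rw [Measure.restrict_apply_univ]
  refine ⟨g2 0, D 0, ?_, ?_, ?_⟩
  · have := moll_bound φ c (c * v1 * ε) 0 h0 hc g1 0 (by simp) (fun w hw => hg1b w (by linarith))
    rw [← hV1, ← hv1c] at this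
    have h : ‖g2 0‖ₑ ≤ ((C1 * ε : ℝ≥0) : ℝ≥0∞) := by
      refine this.trans (le_of_eq ?_)
      rw [hC1d]; push_cast; ring
    have h' : ‖g2 0‖ ≤ ((C1 * ε : ℝ≥0) : ℝ) := by exact_mod_cast h
    exact h'.trans (by exact_mod_cast hC1)
  · refine ContinuousLinearMap.opNorm_le_bound _ (by positivity) fun x => ?_
    rw [hDx]
    have := moll_bound (fun w => fderiv ℝ φ w x) (c * ‖x‖₊) (c * v1 * ε) 0
      (fun k hk => by rw [h0' k hk]; simp)
      (fun k => ((fderiv ℝ φ k).le_opNorm x).trans (by push_cast; gcongr; exact hc' k)) g1 0 (by simp)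
      (fun w hw => hg1b w (by linarith))
    rw [← hV1, ← hv1c] at this
    have h : ‖∫ w, (fderiv ℝ φ w x) • g1 (0 - w)‖ₑ ≤ ((C1 * ε * ‖x‖₊ : ℝ≥0) : ℝ≥0∞) := by
      refine this.trans (le_of_eq ?_)
      rw [hC1d]; push_cast; ring
    have h' : ‖∫ w, (fderiv ℝ φ w x) • g1 (0 - w)‖ ≤ ((C1 * ε * ‖x‖₊ : ℝ≥0) : ℝ) := by
      exact_mod_cast h
    refine h'.trans ?_
    have : C1 * ε * ‖x‖₊ ≤ max C1 C2 * ε * ‖x‖₊ := by gcongr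
    exact_mod_cast this
  · by_cases hc0 : c = 0
    · exfalso
      have : ∀ x, φ x = 0 := fun x => by simpa [hc0] using hc x
      simp [this] at h1
    have hpt : ∀ u ∈ ball (0 : EE n) 1, ‖g u - (g2 0 + D 0 u)‖ₑ ≤
        c * (∫⁻ w in ball (0 : EE n) 1, ‖sdiff2 g u w‖ₑ) + 2 * c ^ 2 * I := by
      intro u hu
      have hu1 : ‖u‖ ≤ 1 := by rw [mem_ball_zero_iff] at hu; exact hu.le
      rcases eq_or_ne I ⊤ with hIt | hIt
      · rw [hIt, ENNReal.mul_top (by simp [hc0]), add_top]; exact le_top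
      have A := moll_sub_le c hφ.continuous hs hg heven h1 h0 hc u
      have B : ‖g2 u - g1 u‖ₑ ≤ c ^ 2 * I := by
        refine (moll_sub_le c hφ.continuous hs hg1c heven h1 h0 hc u).trans ?_
        rw [pow_two, mul_assoc]
        refine mul_le_mul' le_rfl ?_
        rw [hI, ← lintegral_const_mul' _ _ (by simp)]
        refine (lintegral_mono fun k => sdiff2_moll_le c hφ.continuous hs hg h0 hc u k hu1).trans ?_
        exact lintegral_mono_set (ball_subset_ball (by norm_num))
      have Cc : ‖g2 u - g2 0 - D 0 u‖ₑ ≤ c ^ 2 * I := by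
        have hM : ((c : ℝ≥0∞) ^ 2 * I) = ENNReal.ofReal ((c:ℝ) ^ 2 * I.toReal) := by
          rw [ENNReal.ofReal_mul (by positivity), ENNReal.ofReal_toReal hIt,
            ENNReal.ofReal_pow (by positivity)]
          simp
        have hle : ∀ x ∈ ball (0 : EE n) 1, ‖D x - D 0‖ ≤ (c:ℝ) ^ 2 * I.toReal := by
          intro x hx
          rw [mem_ball_zero_iff] at hx
          refine ContinuousLinearMap.opNorm_le_bound _ (by positivity) fun y => ?_
          have := moll_fderiv_sub c hφ hs hg heven h0 h0' hc hc' x hx.le y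
          rw [← hI, hM, ← hg1, ← hDx, ← hDx, ← ofReal_norm, ← ofReal_norm,
            ← ENNReal.ofReal_mul (by positivity), ENNReal.ofReal_le_ofReal_iff (by positivity)] at this
          exact this
        have := Convex.norm_image_sub_le_of_norm_hasFDerivWithin_le' (f := g2) (f' := D) (φ := D 0)
          (s := ball (0 : EE n) 1) (x := 0) (y := u)
          (fun x _ => (hD x).hasFDerivWithinAt) hle (convex_ball _ _) (by simp) hu
        rw [hM, ← ofReal_norm]
        refine ENNReal.ofReal_le_ofReal ?_
        rw [sub_zero] at this
        refine this.trans ?_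
        exact mul_le_of_le_one_right (by positivity) hu1
      calc ‖g u - (g2 0 + D 0 u)‖ₑ = ‖(g2 u - g2 0 - D 0 u) - (g2 u - g1 u) - (g1 u - g u)‖ₑ := by
            congr 1; abel
        _ ≤ ‖g2 u - g2 0 - D 0 u‖ₑ + ‖g2 u - g1 u‖ₑ + ‖g1 u - g u‖ₑ :=
            enorm_sub_le.trans (add_le_add enorm_sub_le le_rfl)
        _ ≤ c ^ 2 * I + c ^ 2 * I + c * (∫⁻ w in ball (0 : EE n) 1, ‖sdiff2 g u w‖ₑ) :=
            add_le_add (add_le_add Cc B) A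
        _ = _ := by ring
    have hpt2 : ∀ u ∈ ball (0 : EE n) 1, ‖g u - (g2 0 + D 0 u)‖ₑ ^ 2 ≤
        2 * c ^ 2 * V * (∫⁻ w in ball (0 : EE n) 2, ‖sdiff2 g u w‖ₑ ^ 2) + 8 * c ^ 4 * V ^ 2 * Q := by
      intro u hu
      refine (pow_le_pow_left' (hpt u hu) 2).trans ?_
      refine (add_sq_le_enn _ _).trans ?_
      have e1 : (∫⁻ w in ball (0 : EE n) 1, ‖sdiff2 g u w‖ₑ) ^ 2 ≤
          V * ∫⁻ w in ball (0 : EE n) 2, ‖sdiff2 g u w‖ₑ ^ 2 := by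
        refine (lintegral_sq_le _ _ (hIm' u).aemeasurable).trans ?_
        rw [Measure.restrict_apply_univ]
        exact mul_le_mul' hV1V (lintegral_mono_set (ball_subset_ball (by norm_num)))
      rw [mul_pow, mul_pow, mul_add]
      refine add_le_add ?_ ?_
      · calc 2 * ((c:ℝ≥0∞) ^ 2 * (∫⁻ w in ball (0 : EE n) 1, ‖sdiff2 g u w‖ₑ) ^ 2)
            ≤ 2 * ((c:ℝ≥0∞) ^ 2 * (V * ∫⁻ w in ball (0 : EE n) 2, ‖sdiff2 g u w‖ₑ ^ 2)) :=
              mul_le_mul' le_rfl (mul_le_mul' le_rfl e1)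
          _ = _ := by ring
      · calc 2 * ((2 * (c:ℝ≥0∞) ^ 2) ^ 2 * I ^ 2) ≤ 2 * ((2 * (c:ℝ≥0∞) ^ 2) ^ 2 * (V ^ 2 * Q)) :=
              mul_le_mul' le_rfl (mul_le_mul' le_rfl hIQ)
          _ = _ := by ring
    have hswap : ∫⁻ u in ball (0 : EE n) 2, ∫⁻ w in ball (0 : EE n) 2, ‖sdiff2 g u w‖ₑ ^ 2 = Q := by
      rw [hQ, lintegral_lintegral_swap]
      exact (hsc.enorm.measurable.pow_const 2).aemeasurable
    calc ∫⁻ u in ball (0 : EE n) 1, ‖g u - (g2 0 + D 0 u)‖ₑ ^ 2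
        ≤ ∫⁻ u in ball (0 : EE n) 1, (2 * c ^ 2 * V * (∫⁻ w in ball (0 : EE n) 2, ‖sdiff2 g u w‖ₑ ^ 2) + 8 * c ^ 4 * V ^ 2 * Q) :=
          setLIntegral_mono' measurableSet_ball hpt2
      _ ≤ ∫⁻ u in ball (0 : EE n) 2, (2 * c ^ 2 * V * (∫⁻ w in ball (0 : EE n) 2, ‖sdiff2 g u w‖ₑ ^ 2) + 8 * c ^ 4 * V ^ 2 * Q) :=
          lintegral_mono_set (ball_subset_ball (by norm_num))
      _ = 2 * c ^ 2 * V * Q + 8 * c ^ 4 * V ^ 2 * Q * V := by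
          rw [lintegral_add_right _ measurable_const, setLIntegral_const, lintegral_const_mul', hswap]
          exact ENNReal.mul_ne_top (ENNReal.mul_ne_top (by simp) (by simp)) hVt
      _ = (C2 : ℝ≥0) * Q := by
          rw [hC2]; push_cast; rw [hvc]; ring
      _ ≤ _ := by
          gcongr; exact le_max_right _ _

lemma setLIntegral_ball_scale {n : ℕ} (F : EE n → ℝ≥0∞) (z : EE n) (ρ : ℝ) (hρ : 0 < ρ) :
    ∫⁻ v in ball z ρ, F v = ENNReal.ofReal ρ ^ n * ∫⁻ u in ball (0 : EE n) 1, F (z + ρ • u) := by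
  rw [← lintegral_indicator measurableSet_ball, ← lintegral_indicator measurableSet_ball,
    ← lintegral_add_left_eq_self (μ := volume) _ z]
  set H : EE n → ℝ≥0∞ := fun v => (ball z ρ).indicator (fun v => F v) (z + v) with hH
  have e : ∀ u, (ball (0 : EE n) 1).indicator (fun u => F (z + ρ • u)) u = H (ρ • u) := by
    intro u
    simp only [hH]
    have : z + ρ • u ∈ ball z ρ ↔ u ∈ ball (0 : EE n) 1 := by
      rw [mem_ball_iff_norm, add_sub_cancel_left, norm_smul, mem_ball_zero_iff, Real.norm_of_nonneg hρ.le]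
      constructor
      · intro h; nlinarith
      · intro h; nlinarith
    by_cases hu : u ∈ ball (0 : EE n) 1
    · rw [indicator_of_mem hu, indicator_of_mem (this.2 hu)]
    · rw [indicator_of_notMem hu, indicator_of_notMem (fun h => hu (this.1 h))]
  simp only [e]
  have hm : MeasurableEmbedding (fun u : EE n => ρ • u) :=
    (Homeomorph.smulOfNeZero ρ hρ.ne').measurableEmbedding
  rw [← hm.lintegral_map, Measure.map_addHaar_smul _ hρ.ne', lintegral_smul_measure, smul_eq_mul, ← mul_assoc]
  simp only [finrank_euclideanSpace, Fintype.card_fin]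
  rw [abs_of_pos (by positivity), ENNReal.ofReal_inv_of_pos (by positivity), ENNReal.ofReal_pow hρ.le,
    ENNReal.mul_inv_cancel, one_mul]
  · positivity
  · exact ENNReal.pow_ne_top ENNReal.ofReal_ne_top

lemma local_affine (n d : ℕ) : ∃ C : ℝ≥0, ∀ f : EE n → EE d, Continuous f → ∀ (z : EE n)
    (T0 : EE n →L[ℝ] EE d), HasFDerivAt f T0 z → ∀ η : ℝ, 0 < η → ∃ ρ0 > 0, ∀ ρ : ℝ, 0 < ρ → ρ < ρ0 →
    ∃ (a : EE d) (T : EE n →L[ℝ] EE d), ‖a - f z‖ ≤ η * ρ ∧ ‖T - T0‖ ≤ η ∧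
      ∫⁻ v in ball z ρ, ‖f v - (a + T (v - z))‖ₑ ^ 2 ≤ C * ENNReal.ofReal ρ ^ n * WW f z ρ := by
  obtain ⟨C, hC⟩ := whitney n d
  refine ⟨C, fun f hf z T0 hT0 η hη => ?_⟩
  set ε' : ℝ := η / (2 * (C + 1)) with hε'
  have hCp : (0:ℝ) < C + 1 := by positivity
  have hε'p : 0 < ε' := by positivity
  have hlit := (hasFDerivAt_iff_isLittleO_nhds_zero.1 hT0).def hε'p
  rw [Metric.eventually_nhds_iff] at hlit
  obtain ⟨ρ1, hρ1, hlit⟩ := hlit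
  refine ⟨ρ1 / 3, by positivity, fun ρ hρ hρ3 => ?_⟩
  set g : EE n → EE d := fun u => f (z + ρ • u) - f z - T0 (ρ • u) with hg
  have hgc : Continuous g := by fun_prop
  have hCε : C * (2 * ε' * ρ) ≤ η * ρ := by
    have : C * (2 * ε') ≤ η := by
      rw [hε']
      rw [show (C:ℝ) * (2 * (η / (2 * (C + 1)))) = η * (C / (C + 1)) by field_simp]
      refine mul_le_of_le_one_right hη.le ?_
      rw [div_le_one hCp]; linarith
    nlinarith
  obtain ⟨a', T', ha', hT', hintg⟩ := hC g hgc (Real.toNNReal (2 * ε' * ρ)) (by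
    intro u hu
    rw [Real.coe_toNNReal _ (by positivity)]
    have h1 : ‖ρ • u‖ ≤ 2 * ρ := by
      rw [norm_smul, Real.norm_of_nonneg hρ.le]; nlinarith
    have := hlit (y := ρ • u) (by rw [dist_zero_right]; linarith)
    refine this.trans ?_
    nlinarith)
  rw [Real.coe_toNNReal _ (by positivity)] at ha' hT'
  refine ⟨f z + a', T0 + ρ⁻¹ • T', ?_, ?_, ?_⟩
  · rw [add_sub_cancel_left]; exact ha'.trans hCε
  · rw [add_sub_cancel_left, norm_smul, norm_inv, Real.norm_of_nonneg hρ.le]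
    rw [inv_mul_le_iff₀ hρ]
    linarith
  · rw [setLIntegral_ball_scale _ z ρ hρ]
    have e1 : ∀ u, f (z + ρ • u) - (f z + a' + (T0 + ρ⁻¹ • T') (z + ρ • u - z)) = g u - (a' + T' u) := by
      intro u
      have h1 : (T0 + ρ⁻¹ • T') (z + ρ • u - z) = T0 (ρ • u) + T' u := by
        rw [add_sub_cancel_left, ContinuousLinearMap.add_apply, ContinuousLinearMap.smul_apply, map_smul T', smul_smul, inv_mul_cancel₀ hρ.ne', one_smul]
      rw [h1]
      simp only [hg]
      abel
    simp only [e1]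
    have e2 : ∀ w k, sdiff2 g w k = sdiff2 f (z + ρ • w) (ρ • k) := by
      intro w k
      simp only [sdiff2, hg, smul_add, smul_sub, map_add, map_sub, two_smul, add_assoc, ← add_sub_assoc]
      abel
    simp only [e2] at hintg
    rw [mul_comm (C:ℝ≥0∞), mul_assoc]
    exact mul_le_mul' le_rfl hintg

lemma geom_aux (ρ : ℝ≥0∞) (N : ℕ) : ∀ e : ℝ≥0∞,
    3 * (∑ j ∈ Finset.range N, if 2 ^ j * e < ρ then (2 ^ j * e) ^ 2 else 0) +
      (if e < ρ then e ^ 2 else 0) ≤ 4 * ρ ^ 2 := by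
  induction N with
  | zero =>
    intro e
    simp only [Finset.range_zero, Finset.sum_empty, mul_zero, zero_add]
    split_ifs with h
    · calc e ^ 2 ≤ ρ ^ 2 := pow_le_pow_left' h.le 2
        _ ≤ 4 * ρ ^ 2 := le_mul_of_one_le_left' (by norm_num)
    · exact zero_le
  | succ N ih =>
    intro e
    rw [Finset.sum_range_succ']
    have h2 : ∀ j : ℕ, (2:ℝ≥0∞) ^ (j + 1) * e = 2 ^ j * (2 * e) := fun j => by ring
    simp only [h2, pow_zero, one_mul]
    by_cases h : 2 * e < ρ
    · have he : e < ρ := lt_of_le_of_lt (le_mul_of_one_le_left' (by norm_num)) h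
      have := ih (2 * e)
      rw [if_pos h] at this
      rw [if_pos he]
      refine le_trans (le_of_eq ?_) this
      ring
    · have h0 : ∀ j : ℕ, ¬ (2 ^ j * (2 * e) < ρ) := fun j hj =>
        h (lt_of_le_of_lt (le_mul_of_one_le_left' (one_le_pow₀ (by norm_num))) hj)
      simp only [h0, if_false, Finset.sum_const_zero, zero_add]
      split_ifs with h
      · calc 3 * e ^ 2 + e ^ 2 = 4 * e ^ 2 := by ring
          _ ≤ _ := mul_le_mul' le_rfl (pow_le_pow_left' h.le 2)
      · simp

lemma geom_sum (ρ e : ℝ≥0∞) :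
    (∑' j : ℕ, if 2 ^ j * e < ρ then (2 ^ j * e) ^ 2 else 0) ≤ 4 * ρ ^ 2 := by
  rw [ENNReal.tsum_eq_iSup_nat]
  refine iSup_le fun N => ?_
  refine le_trans ?_ (geom_aux ρ N e)
  refine le_trans ?_ (le_add_of_nonneg_right zero_le)
  exact le_mul_of_one_le_left' (by norm_num)

lemma marc {n : ℕ} {Y : Type*} [MetricSpace Y] [MeasurableSpace Y] [BorelSpace Y]
    [SecondCountableTopology Y] (F : EE n → Y) (hF : Continuous F) (Z : Set (EE n))
    (hZ : MeasurableSet Z) (Q : ℝ≥0) (hQ : ∀ z ∈ Z, ∀ z' ∈ Z, dist z z' ≤ Q * dist (F z) (F z'))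
    (m : Measure Y) [IsFiniteMeasure m] (R : ℝ) (hR : 0 < R) :
    ∀ᵐ z ∂(volume.restrict Z), ∑' j : ℕ, ((2:ℝ≥0∞) ^ (n + 2)) ^ j *
      ∫⁻ y in ball (F z) (R * (2:ℝ)⁻¹ ^ j), infEDist y (F '' Z) ^ 2 ∂m < ⊤ := by
  set e : Y → ℝ≥0∞ := fun y => infEDist y (F '' Z) with he
  have hem : Measurable e := measurable_infEDist
  set G : ℕ → EE n → Y → ℝ≥0∞ := fun j z y => (ball (F z) (R * (2:ℝ)⁻¹ ^ j)).indicator (fun y => e y ^ 2) y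
  have hGm : ∀ j, Measurable (Function.uncurry (G j)) := by
    intro j
    have hs : MeasurableSet {p : EE n × Y | dist p.2 (F p.1) < R * (2:ℝ)⁻¹ ^ j} :=
      (isOpen_lt (by fun_prop) continuous_const).measurableSet
    have : Function.uncurry (G j) =
        {p : EE n × Y | dist p.2 (F p.1) < R * (2:ℝ)⁻¹ ^ j}.indicator (fun p => e p.2 ^ 2) := by
      ext ⟨z, y⟩
      rfl
    rw [this]
    exact ((hem.comp measurable_snd).pow_const 2).indicator hs
  have hconv : ∀ j z, ∫⁻ y in ball (F z) (R * (2:ℝ)⁻¹ ^ j), infEDist y (F '' Z) ^ 2 ∂m = ∫⁻ y, G j z y ∂m := by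
    intro j z
    rw [← lintegral_indicator measurableSet_ball]
  have hmz : ∀ j, Measurable fun z => ∫⁻ y, G j z y ∂m := fun j => (hGm j).lintegral_prod_right'
  simp only [hconv]
  refine ae_lt_top (Measurable.tsum fun j => (hmz j).const_mul _) ?_
  rw [lintegral_tsum (fun j => ((hmz j).const_mul _).aemeasurable)]
  set V : ℝ≥0∞ := volume (ball (0 : EE n) 1)
  set C : ℝ≥0∞ := ENNReal.ofReal ((2 * Q * R) ^ n) * V with hC
  have hCt : C ≠ ⊤ := ENNReal.mul_ne_top (by simp) measure_ball_lt_top.ne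
  have hterm : ∀ j, ∫⁻ z in Z, ((2:ℝ≥0∞) ^ (n + 2)) ^ j * ∫⁻ y, G j z y ∂m ≤
      ∫⁻ y, C * (if 2 ^ j * e y < ENNReal.ofReal R then (2 ^ j * e y) ^ 2 else 0) ∂m := by
    intro j
    rw [lintegral_const_mul _ (hmz j), lintegral_lintegral_swap (hGm j).aemeasurable,
      ← lintegral_const_mul']
    swap
    · simp
    refine lintegral_mono fun y => ?_
    have hset : ∫⁻ z in Z, G j z y = e y ^ 2 * volume (Z ∩ {z | dist y (F z) < R * (2:ℝ)⁻¹ ^ j}) := by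
      have hs : MeasurableSet {z : EE n | dist y (F z) < R * (2:ℝ)⁻¹ ^ j} :=
        (isOpen_lt (by fun_prop) continuous_const).measurableSet
      have : ∀ z, G j z y = {z : EE n | dist y (F z) < R * (2:ℝ)⁻¹ ^ j}.indicator (fun _ => e y ^ 2) z :=
        fun z => rfl
      simp only [this]
      rw [lintegral_indicator hs, setLIntegral_const, Measure.restrict_apply hs, inter_comm]
    simp only [hset]
    rcases (Z ∩ {z | dist y (F z) < R * (2:ℝ)⁻¹ ^ j}).eq_empty_or_nonempty with h0 | ⟨z0, hz0, hz0'⟩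
    · rw [h0]; simp
    have hr : 0 < R * (2:ℝ)⁻¹ ^ j := by positivity
    have hlt : 2 ^ j * e y < ENNReal.ofReal R := by
      have h1 : e y < ENNReal.ofReal (R * (2:ℝ)⁻¹ ^ j) := by
        refine lt_of_le_of_lt (infEDist_le_edist_of_mem (mem_image_of_mem F hz0)) ?_
        rw [edist_dist]
        exact (ENNReal.ofReal_lt_ofReal_iff hr).2 hz0'
      have h2 : ENNReal.ofReal R = 2 ^ j * ENNReal.ofReal (R * (2:ℝ)⁻¹ ^ j) := by
        have : (2:ℝ≥0∞) ^ j = ENNReal.ofReal (2 ^ j) := by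
          rw [ENNReal.ofReal_pow (by norm_num)]; simp
        rw [this, ← ENNReal.ofReal_mul (by positivity)]
        congr 1
        rw [inv_pow]; field_simp
      rw [h2]
      exact (ENNReal.mul_lt_mul_iff_right (by simp) (by simp)).2 h1
    rw [if_pos hlt]
    have hvol : volume (Z ∩ {z | dist y (F z) < R * (2:ℝ)⁻¹ ^ j}) ≤
        ENNReal.ofReal ((2 * Q * (R * (2:ℝ)⁻¹ ^ j)) ^ n) * V := by
      have : volume (closedBall z0 (2 * Q * (R * (2:ℝ)⁻¹ ^ j))) =
          ENNReal.ofReal ((2 * Q * (R * (2:ℝ)⁻¹ ^ j)) ^ n) * V := by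
        rw [Measure.addHaar_closedBall _ _ (by positivity)]; simp [V]
      rw [← this]
      refine measure_mono ?_
      rintro z ⟨hz, hz'⟩
      rw [mem_closedBall]
      refine (hQ z hz z0 hz0).trans ?_
      have h3 : dist (F z) (F z0) ≤ 2 * (R * (2:ℝ)⁻¹ ^ j) := by
        have := dist_triangle_left (F z) (F z0) y
        simp only [mem_setOf_eq] at hz' hz0'
        linarith
      have := mul_le_mul_of_nonneg_left h3 Q.coe_nonneg
      linarith
    refine (mul_le_mul' le_rfl (mul_le_mul' le_rfl hvol)).trans (le_of_eq ?_)
    have h4 : ENNReal.ofReal ((2 * Q * (R * (2:ℝ)⁻¹ ^ j)) ^ n) =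
        ENNReal.ofReal ((2 * Q * R) ^ n) * ((2:ℝ≥0∞)⁻¹ ^ j) ^ n := by
      have : ((2:ℝ≥0∞)⁻¹ ^ j) = ENNReal.ofReal ((2:ℝ)⁻¹ ^ j) := by
        rw [ENNReal.ofReal_pow (by norm_num), ENNReal.ofReal_inv_of_pos (by norm_num)]; simp
      rw [this, ← ENNReal.ofReal_pow (by positivity), ← ENNReal.ofReal_mul (by positivity), ← mul_pow]
      congr 2
      ring
    have h5 : ((2:ℝ≥0∞) ^ j) ^ n * ((2:ℝ≥0∞)⁻¹ ^ j) ^ n = 1 := by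
      rw [← mul_pow, ← mul_pow, ENNReal.mul_inv_cancel (by simp) (by simp), one_pow, one_pow]
    rw [h4, hC]
    calc ((2:ℝ≥0∞) ^ (n + 2)) ^ j * (e y ^ 2 * (ENNReal.ofReal ((2 * Q * R) ^ n) * ((2:ℝ≥0∞)⁻¹ ^ j) ^ n * V))
        = (((2:ℝ≥0∞) ^ j) ^ n * ((2:ℝ≥0∞)⁻¹ ^ j) ^ n) * (ENNReal.ofReal ((2 * Q * R) ^ n) * V * (2 ^ j * e y) ^ 2) := by
            have h6 : ((2:ℝ≥0∞) ^ (n + 2)) ^ j = ((2:ℝ≥0∞) ^ j) ^ n * ((2:ℝ≥0∞) ^ j) ^ 2 := by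
              rw [← pow_mul, ← pow_mul, ← pow_mul, ← pow_add]; congr 1; ring
            rw [h6]
            generalize (2:ℝ≥0∞) ^ j = A
            generalize (2:ℝ≥0∞)⁻¹ ^ j = B
            generalize ENNReal.ofReal ((2 * Q * R) ^ n) = D
            ring
      _ = _ := by rw [h5, one_mul]
  refine ne_top_of_le_ne_top ?_ (ENNReal.tsum_le_tsum hterm)
  have hmm : ∀ j : ℕ, Measurable fun y => (if 2 ^ j * e y < ENNReal.ofReal R then (2 ^ j * e y) ^ 2 else 0) := by
    intro j
    refine Measurable.ite ?_ ((hem.const_mul _).pow_const 2) measurable_const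
    exact measurableSet_lt (hem.const_mul _) measurable_const
  rw [← lintegral_tsum (fun j => ((hmm j).const_mul _).aemeasurable)]
  refine ne_top_of_le_ne_top (b := ∫⁻ y, C * (4 * ENNReal.ofReal R ^ 2) ∂m) ?_ (lintegral_mono fun y => ?_)
  · rw [lintegral_const]
    refine ENNReal.mul_ne_top (ENNReal.mul_ne_top hCt (ENNReal.mul_ne_top (by simp) (by simp))) (measure_ne_top _ _)
  · rw [ENNReal.tsum_mul_left]
    exact mul_le_mul' le_rfl (geom_sum _ _)

lemma density_ae {n : ℕ} (ν : Measure (EE n)) [IsFiniteMeasure ν] :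
    ∀ᵐ z : EE n, ∃ M : ℕ, ∀ r : ℝ, 0 < r → ν (closedBall z r) ≤ M * ENNReal.ofReal r ^ n := by
  filter_upwards [Besicovitch.ae_tendsto_rnDeriv ν volume, Measure.rnDeriv_lt_top ν volume] with z hz hzt
  set D := ν.rnDeriv volume z with hD
  have h1 : ∀ᶠ r in nhdsWithin (0:ℝ) (Ioi 0), ν (closedBall z r) / volume (closedBall z r) < D + 1 :=
    hz.eventually (gt_mem_nhds (ENNReal.lt_add_right hzt.ne (by simp)))
  rw [eventually_nhdsWithin_iff, Metric.eventually_nhds_iff] at h1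
  obtain ⟨r0, hr0, h1⟩ := h1
  set V : ℝ≥0∞ := volume (ball (0 : EE n) 1) with hV
  have hVt : V ≠ ⊤ := measure_ball_lt_top.ne
  set A : ℝ≥0∞ := (D + 1) * V + ν univ / ENNReal.ofReal r0 ^ n with hA
  have hr0n : ENNReal.ofReal r0 ^ n ≠ 0 := pow_ne_zero _ (by simpa using hr0)
  have hr0t : ENNReal.ofReal r0 ^ n ≠ ⊤ := by simp
  have hAt : A ≠ ⊤ := by
    refine ENNReal.add_ne_top.2 ⟨ENNReal.mul_ne_top (by simp [hzt.ne]) hVt, ?_⟩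
    exact ENNReal.div_ne_top (measure_ne_top _ _) hr0n
  obtain ⟨M, hM⟩ := ENNReal.exists_nat_gt hAt
  refine ⟨M, fun r hr => ?_⟩
  refine le_trans ?_ (mul_le_mul' hM.le le_rfl)
  rw [hA, add_mul]
  by_cases hrr : r < r0
  · refine le_trans ?_ (le_add_of_nonneg_right zero_le)
    have h2 := (h1 (y := r) (by rw [dist_zero_right, Real.norm_of_nonneg hr.le]; exact hrr) hr).le
    have h3 : volume (closedBall z r) = ENNReal.ofReal r ^ n * V := by
      rw [Measure.addHaar_closedBall _ _ hr.le, ENNReal.ofReal_pow hr.le]; simp [hV]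
    rw [ENNReal.div_le_iff (measure_closedBall_pos _ _ hr).ne' measure_closedBall_lt_top.ne, h3] at h2
    refine h2.trans (le_of_eq ?_)
    ring
  · refine le_trans ?_ (le_add_of_nonneg_left zero_le)
    push Not at hrr
    calc ν (closedBall z r) ≤ ν univ := measure_mono (subset_univ _)
      _ = ν univ / ENNReal.ofReal r0 ^ n * ENNReal.ofReal r0 ^ n := (ENNReal.div_mul_cancel hr0n hr0t).symm
      _ ≤ _ := by gcongr

lemma lemmaS {n d : ℕ} (ν : Measure (EE n)) [IsFiniteMeasure ν] (Z : Set (EE n)) (M : ℝ≥0∞)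
    (hM : ∀ z ∈ Z, ∀ r : ℝ, 0 < r → ν (closedBall z r) ≤ M * ENNReal.ofReal r ^ n)
    (h : EE n → EE d) (Λ : ℝ≥0) (hh : LipschitzWith Λ h) (z : EE n) (hz : z ∈ closure Z)
    (ρ : ℝ) (hρ : 0 < ρ) :
    ∫⁻ w in ball z ρ, ‖h w‖ₑ ^ 2 ∂ν ≤
      2 * 9 ^ n * (volume (ball (0 : EE n) 1))⁻¹ * M * (∫⁻ v in ball z (2 * ρ), ‖h v‖ₑ ^ 2) +
        2 * Λ ^ 2 * ∫⁻ w in ball z ρ, infEDist w Z ^ 2 ∂ν := by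
  have hZne : Z.Nonempty := closure_nonempty_iff.1 ⟨z, hz⟩
  set V : ℝ≥0∞ := volume (ball (0 : EE n) 1) with hV
  have hVt : V ≠ ⊤ := measure_ball_lt_top.ne
  have hV0 : V ≠ 0 := (measure_ball_pos _ _ one_pos).ne'
  set A := ∫⁻ v in ball z (2 * ρ), ‖h v‖ₑ ^ 2 with hA
  set B := ∫⁻ w in ball z ρ, infEDist w Z ^ 2 ∂ν with hB
  have hhm : Measurable fun v => ‖h v‖ₑ ^ 2 := (hh.continuous.enorm.measurable).pow_const 2
  -- the estimate for each small τ
  have key : ∀ τ : ℝ, 0 < τ → τ ≤ ρ → ∫⁻ w in ball z ρ, ‖h w‖ₑ ^ 2 ∂ν ≤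
      2 * 9 ^ n * V⁻¹ * M * A + 2 * Λ ^ 2 * (B + ENNReal.ofReal τ ^ 2 * ν (ball z ρ)) := by
    intro τ hτ hτρ
    set t : EE n → ℝ := fun w => max (infDist w Z) τ with ht
    have htc : Continuous t := (continuous_infDist_pt Z).max continuous_const
    have htp : ∀ w, 0 < t w := fun w => lt_max_of_lt_right hτ
    have htl : ∀ v w, t v ≤ t w + dist v w := by
      intro v w
      refine max_le ?_ ?_
      · exact infDist_le_infDist_add_dist.trans (by gcongr; exact le_max_left _ _)
      · exact (le_max_right _ _).trans (le_add_of_nonneg_right dist_nonneg)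
    set W : EE n → ℝ≥0∞ := fun w => ENNReal.ofReal (t w / 2) ^ n * V with hW
    have hWm : Measurable W := by
      refine Measurable.mul_const (Measurable.pow_const ?_ n) V
      exact (ENNReal.continuous_ofReal.comp (htc.div_const 2)).measurable
    have hW0 : ∀ w, W w ≠ 0 := fun w => mul_ne_zero (pow_ne_zero _ (by simpa using htp w)) hV0
    have hWt : ∀ w, W w ≠ ⊤ := fun w => ENNReal.mul_ne_top (by simp) hVt
    have hWv : ∀ w, volume (ball w (t w / 2)) = W w := by
      intro w
      rw [Measure.addHaar_ball_of_pos _ _ (by have := htp w; positivity)]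
      simp only [finrank_euclideanSpace, Fintype.card_fin, hW]
      rw [ENNReal.ofReal_pow (by have := htp w; positivity)]
    set G : EE n → EE n → ℝ≥0∞ := fun w v =>
      {p : EE n × EE n | dist p.2 p.1 < t p.1 / 2}.indicator (fun p => (W p.1)⁻¹ * (2 * ‖h p.2‖ₑ ^ 2)) (w, v) with hG
    have hGm : Measurable (Function.uncurry G) := by
      refine Measurable.indicator ?_ ?_
      · exact (hWm.comp measurable_fst).inv.mul ((hhm.comp measurable_snd).const_mul 2)
      · exact (isOpen_lt (by fun_prop) (by fun_prop)).measurableSet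
    have hpt : ∀ w, ‖h w‖ₑ ^ 2 ≤ (∫⁻ v, G w v) + 2 * Λ ^ 2 * ENNReal.ofReal (t w) ^ 2 := by
      intro w
      have e1 : ∫⁻ v, G w v = (W w)⁻¹ * ∫⁻ v in ball w (t w / 2), 2 * ‖h v‖ₑ ^ 2 := by
        rw [← lintegral_const_mul _ (hhm.const_mul 2), ← lintegral_indicator measurableSet_ball]
        rfl
      have e2 : W w * ‖h w‖ₑ ^ 2 ≤ (∫⁻ v in ball w (t w / 2), 2 * ‖h v‖ₑ ^ 2) +
          2 * Λ ^ 2 * ENNReal.ofReal (t w) ^ 2 * W w := by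
        rw [← hWv w, ← setLIntegral_const, mul_comm, ← setLIntegral_const,
          ← lintegral_add_right _ measurable_const]
        refine setLIntegral_mono' measurableSet_ball fun v hv => ?_
        have h1 : ‖h w‖ₑ ≤ ‖h v‖ₑ + Λ * ENNReal.ofReal (t w) := by
          calc ‖h w‖ₑ = ‖h v + (h w - h v)‖ₑ := by congr 1; abel
            _ ≤ ‖h v‖ₑ + ‖h w - h v‖ₑ := enorm_add_le _ _
            _ ≤ _ := by
              gcongr
              rw [← edist_eq_enorm_sub]
              refine (hh w v).trans ?_
              gcongr
              rw [edist_dist]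
              apply ENNReal.ofReal_le_ofReal
              rw [mem_ball, dist_comm] at hv
              linarith [htp w]
        refine (pow_le_pow_left' h1 2).trans ((add_sq_le_enn _ _).trans (le_of_eq ?_))
        ring
      rw [e1]
      calc ‖h w‖ₑ ^ 2 = (W w)⁻¹ * (W w * ‖h w‖ₑ ^ 2) := by
            rw [← mul_assoc, ENNReal.inv_mul_cancel (hW0 w) (hWt w), one_mul]
        _ ≤ (W w)⁻¹ * ((∫⁻ v in ball w (t w / 2), 2 * ‖h v‖ₑ ^ 2) +
          2 * Λ ^ 2 * ENNReal.ofReal (t w) ^ 2 * W w) := mul_le_mul' le_rfl e2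
        _ = (W w)⁻¹ * (∫⁻ v in ball w (t w / 2), 2 * ‖h v‖ₑ ^ 2) +
          2 * Λ ^ 2 * ENNReal.ofReal (t w) ^ 2 * ((W w)⁻¹ * W w) := by ring
        _ = _ := by rw [ENNReal.inv_mul_cancel (hW0 w) (hWt w), mul_one]
    have htn : ∀ w, ENNReal.ofReal (t w) ^ 2 ≤ infEDist w Z ^ 2 + ENNReal.ofReal τ ^ 2 := by
      intro w
      have h1 : ENNReal.ofReal (t w) = max (infEDist w Z) (ENNReal.ofReal τ) := by
        simp only [ht]
        rw [ENNReal.ofReal_max, infDist, ENNReal.ofReal_toReal (infEDist_ne_top hZne)]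
      rw [h1]
      rcases le_total (infEDist w Z) (ENNReal.ofReal τ) with h2 | h2
      · rw [max_eq_right h2]; exact le_add_of_nonneg_left zero_le
      · rw [max_eq_left h2]; exact le_add_of_nonneg_right zero_le
    have hG1 : ∫⁻ w in ball z ρ, (∫⁻ v, G w v) ∂ν ≤ 2 * 9 ^ n * V⁻¹ * M * A := by
      rw [lintegral_lintegral_swap hGm.aemeasurable, hA,
        ← lintegral_const_mul _ hhm, ← lintegral_indicator measurableSet_ball]
      refine lintegral_mono fun v => ?_
      by_cases hv : v ∈ ball z (2 * ρ)
      · rw [indicator_of_mem hv]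
        set c : ℝ≥0∞ := (ENNReal.ofReal (t v / 3) ^ n * V)⁻¹ * (2 * ‖h v‖ₑ ^ 2) with hc
        have h1 : ∀ w, G w v ≤ (ball v (t v)).indicator (fun _ => c) w := by
          intro w
          by_cases hw : dist v w < t w / 2
          · have h2 := htl w v
            have h3 := htl v w
            rw [dist_comm] at h2
            have h4 : w ∈ ball v (t v) := by rw [mem_ball, dist_comm]; linarith
            rw [indicator_of_mem h4]
            simp only [hG]
            rw [indicator_of_mem (by exact hw)]
            simp only [hc, hW]
            have h5 : t v / 3 ≤ t w / 2 := by linarith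
            refine mul_le_mul' (ENNReal.inv_le_inv.2 (mul_le_mul' (pow_le_pow_left' ?_ n) le_rfl)) le_rfl
            exact ENNReal.ofReal_le_ofReal h5
          · simp only [hG]
            rw [indicator_of_notMem (by exact hw)]
            exact zero_le
        obtain ⟨z', hz', hvz'⟩ := (infDist_lt_iff (x := v) (r := 2 * t v) hZne).1
          (lt_of_le_of_lt (le_max_left _ _ : _ ≤ t v) (by linarith [htp v]))
        calc ∫⁻ w in ball z ρ, G w v ∂ν ≤ ∫⁻ w, G w v ∂ν := setLIntegral_le_lintegral _ _
          _ ≤ ∫⁻ w, (ball v (t v)).indicator (fun _ => c) w ∂ν := lintegral_mono h1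
          _ = c * ν (ball v (t v)) := by
              rw [lintegral_indicator measurableSet_ball, setLIntegral_const]
          _ ≤ c * (M * ENNReal.ofReal (3 * t v) ^ n) := by
              gcongr
              refine le_trans (measure_mono ?_) (hM z' hz' (3 * t v) (by linarith [htp v]))
              intro w hw
              rw [mem_ball] at hw
              rw [mem_closedBall]
              linarith [dist_triangle w v z']
          _ = _ := by
              have e3 : ENNReal.ofReal (3 * t v) = 9 * ENNReal.ofReal (t v / 3) := by
                rw [show (9:ℝ≥0∞) = ENNReal.ofReal 9 by simp, ← ENNReal.ofReal_mul (by norm_num)]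
                congr 1; ring
              rw [e3, hc]
              have hn0 : ENNReal.ofReal (t v / 3) ^ n ≠ 0 := pow_ne_zero _ (by simpa using htp v)
              have hnt : ENNReal.ofReal (t v / 3) ^ n ≠ ⊤ := by simp
              rw [ENNReal.mul_inv (Or.inl hn0) (Or.inl hnt), mul_pow]
              generalize ENNReal.ofReal (t v / 3) ^ n = X at *
              calc X⁻¹ * V⁻¹ * (2 * ‖h v‖ₑ ^ 2) * (M * (9 ^ n * X)) =
                  (X⁻¹ * X) * (2 * 9 ^ n * V⁻¹ * M * ‖h v‖ₑ ^ 2) := by ring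
                _ = _ := by rw [ENNReal.inv_mul_cancel hn0 hnt, one_mul]
      · rw [indicator_of_notMem hv]
        refine le_of_eq ?_
        rw [setLIntegral_eq_zero_iff measurableSet_ball hGm.of_uncurry_right]
        refine Filter.Eventually.of_forall fun w hw => ?_
        simp only [hG]
        refine indicator_of_notMem ?_ _
        intro hvw
        simp only [mem_ofPred_eq] at hvw
        apply hv
        rw [mem_ball] at hw ⊢
        have h5 : t w ≤ ρ := by
          refine max_le ?_ hτρ
          rw [← infDist_closure]
          exact (infDist_le_dist_of_mem hz).trans hw.le
        linarith [dist_triangle v w z]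
    calc ∫⁻ w in ball z ρ, ‖h w‖ₑ ^ 2 ∂ν
        ≤ ∫⁻ w in ball z ρ, ((∫⁻ v, G w v) + 2 * Λ ^ 2 * (infEDist w Z ^ 2 + ENNReal.ofReal τ ^ 2)) ∂ν := by
          refine lintegral_mono fun w => (hpt w).trans ?_
          exact add_le_add le_rfl (mul_le_mul' le_rfl (htn w))
      _ = (∫⁻ w in ball z ρ, (∫⁻ v, G w v) ∂ν) + 2 * Λ ^ 2 * (B + ENNReal.ofReal τ ^ 2 * ν (ball z ρ)) := by
          have hmm : Measurable fun w => ∫⁻ v, G w v := hGm.lintegral_prod_right'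
          rw [lintegral_add_left hmm, lintegral_const_mul' _ _ (by finiteness),
            lintegral_add_right _ measurable_const, setLIntegral_const]
      _ ≤ _ := add_le_add hG1 le_rfl
  -- let τ → 0
  refine ENNReal.le_of_forall_pos_le_add fun ε hε _ => ?_
  have htend : Filter.Tendsto (fun τ : ℝ => 2 * (Λ:ℝ≥0∞) ^ 2 * (ENNReal.ofReal τ ^ 2 * ν (ball z ρ)))
      (nhdsWithin 0 (Ioi 0)) (nhds 0) := by
    have : Filter.Tendsto (fun τ : ℝ => ENNReal.ofReal τ) (nhdsWithin 0 (Ioi 0)) (nhds 0) := by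
      have := (ENNReal.continuous_ofReal.tendsto 0)
      rw [ENNReal.ofReal_zero] at this
      exact this.mono_left nhdsWithin_le_nhds
    have h2 := (ENNReal.Tendsto.mul_const (b := ν (ball z ρ)) (ENNReal.Tendsto.pow (n := 2) this)
      (Or.inr (measure_ne_top _ _)))
    have h3 := ENNReal.Tendsto.const_mul (a := 2 * (Λ:ℝ≥0∞) ^ 2) h2 (Or.inr (by finiteness))
    simpa using h3
  have hev := (htend.eventually_lt_const (show (0:ℝ≥0∞) < ε by exact_mod_cast hε)).and
    (Ioo_mem_nhdsGT hρ)
  obtain ⟨τ, h1, h2⟩ := hev.exists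
  refine (key τ h2.1 h2.2.le).trans ?_
  rw [mul_add, ← add_assoc]
  exact add_le_add le_rfl h1.le

lemma degenerate_piece {n d : ℕ} (f : EE n → EE d) (K : ℝ≥0) (A : EE n →L[ℝ] EE d) (hA : ‖A‖ ≤ K)
    (u : EE n) (hu : ‖u‖ = 1) (hAu : A u = 0) (ε : ℝ≥0) (hε0 : 0 < ε) (hε1 : ε ≤ 1) (s : Set (EE n))
    (hs : ApproximatesLinearOn f A s ε) :
    μH[(n:ℝ)] (f '' s) ≤ (2 * K + 3) ^ n * (ε * μH[(n:ℝ)] s) := by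
  set S : EE n →ₗ[ℝ] EE n := LinearMap.transvection ((innerSL ℝ u : EE n →L[ℝ] ℝ) : EE n →ₗ[ℝ] ℝ)
    (((ε:ℝ) - 1) • u) with hS
  have hSx : ∀ h, S h = h + inner ℝ u h • (((ε:ℝ) - 1) • u) := fun h => rfl
  have huu : inner ℝ u u = (1:ℝ) := by rw [real_inner_self_eq_norm_sq, hu]; norm_num
  have hdet : LinearMap.det S = ε := by
    rw [hS, LinearMap.transvection.det]
    have : ((innerSL ℝ u : EE n →L[ℝ] ℝ) : EE n →ₗ[ℝ] ℝ) (((ε:ℝ) - 1) • u) = inner ℝ u (((ε:ℝ) - 1) • u) := rfl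
    rw [this, inner_smul_right, huu]; ring
  have b1 : ∀ h, ε * |inner ℝ u h| ≤ ‖S h‖ := by
    intro h
    have h1 : inner ℝ u (S h) = ε * inner ℝ u h := by
      rw [hSx, inner_add_right, inner_smul_right, inner_smul_right, huu]; ring
    have h2 := abs_real_inner_le_norm u (S h)
    rw [h1, hu, one_mul, abs_mul, NNReal.abs_eq] at h2
    exact h2
  have b2 : ∀ h, ‖h - inner ℝ u h • u‖ ≤ 2 * ‖S h‖ := by
    intro h
    have h1 : h - inner ℝ u h • u = S h - ((ε:ℝ) * inner ℝ u h) • u := by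
      rw [hSx]; module
    have h2 : ‖((ε:ℝ) * inner ℝ u h) • u‖ ≤ ‖S h‖ := by
      rw [norm_smul, hu, mul_one, norm_mul, Real.norm_eq_abs, Real.norm_eq_abs, NNReal.abs_eq]; exact b1 h
    rw [h1]
    linarith [norm_sub_le (S h) (((ε:ℝ) * inner ℝ u h) • u)]
  have b3 : ∀ x ∈ s, ∀ y ∈ s, ‖f x - f y‖ ≤ (2 * K + 3) * ‖S (x - y)‖ := by
    intro x hx y hy
    have h1 : ‖f x - f y - A (x - y)‖ ≤ ε * ‖x - y‖ := hs x hx y hy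
    generalize x - y = h at *
    have h2 : A h = A (h - inner ℝ u h • u) := by rw [map_sub, map_smul, hAu, smul_zero, sub_zero]
    have h3 : ‖A h‖ ≤ K * (2 * ‖S h‖) := by
      rw [h2]
      exact (A.le_opNorm _).trans (mul_le_mul hA (b2 h) (norm_nonneg _) K.coe_nonneg)
    have h4 : ‖h‖ ≤ ‖h - inner ℝ u h • u‖ + |inner ℝ u h| := by
      have : ‖inner ℝ u h • u‖ = |inner ℝ u h| := by rw [norm_smul, hu, mul_one, Real.norm_eq_abs]
      rw [← this]
      calc ‖h‖ = ‖(h - inner ℝ u h • u) + inner ℝ u h • u‖ := by rw [sub_add_cancel]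
        _ ≤ _ := norm_add_le _ _
    have h5 : ε * ‖h‖ ≤ 3 * ‖S h‖ := by
      have h6 : (ε:ℝ) ≤ 1 := by exact_mod_cast hε1
      have h7 : (ε:ℝ) * ‖h - inner ℝ u h • u‖ ≤ 2 * ‖S h‖ :=
        (mul_le_of_le_one_left (norm_nonneg _) h6).trans (b2 h)
      have h8 := mul_le_mul_of_nonneg_left h4 ε.coe_nonneg
      linarith [b1 h]
    calc ‖f x - f y‖ = ‖(f x - f y - A h) + A h‖ := by rw [sub_add_cancel]
      _ ≤ ‖f x - f y - A h‖ + ‖A h‖ := norm_add_le _ _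
      _ ≤ _ := by linarith
  have hSi : Function.Injective S := by
    have h0 : LinearMap.det S ≠ 0 := by rw [hdet]; exact_mod_cast hε0.ne'
    exact (LinearMap.equivOfDetNeZero S h0).injective
  set g : EE n → EE d := fun a => f (Function.invFun S a) with hg
  have hgS : ∀ x, g (S x) = f x := fun x => by simp only [hg]; rw [Function.leftInverse_invFun hSi]
  have hgl : LipschitzOnWith (2 * K + 3) g (S '' s) := by
    refine LipschitzOnWith.of_dist_le_mul ?_
    rintro _ ⟨x, hx, rfl⟩ _ ⟨y, hy, rfl⟩
    rw [hgS, hgS, dist_eq_norm, dist_eq_norm, ← map_sub]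
    exact_mod_cast b3 x hx y hy
  have him : f '' s = g '' (S '' s) := by
    rw [image_image]; simp only [hgS]
  rw [him]
  refine (hgl.hausdorffMeasure_image_le (by positivity)).trans ?_
  rw [Measure.addHaar_image_linearMap, hdet, NNReal.abs_eq, ENNReal.ofReal_coe_nnreal, ENNReal.rpow_natCast]
  push_cast
  exact le_rfl

lemma degenerate_null {n d : ℕ} (f : EE n → EE d) (K : ℝ≥0) (hf : LipschitzWith K f) :
    μH[(n:ℝ)] (f '' {z | DifferentiableAt ℝ f z ∧ ¬ Function.Injective (fderiv ℝ f z)}) = 0 := by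
  set S : Set (EE n) := {z | DifferentiableAt ℝ f z ∧ ¬ Function.Injective (fderiv ℝ f z)} with hS
  have hcov : f '' S ⊆ ⋃ k : ℕ, f '' (S ∩ ball 0 k) := by
    rintro _ ⟨z, hz, rfl⟩
    obtain ⟨k, hk⟩ := exists_nat_gt ‖z‖
    exact mem_iUnion.2 ⟨k, z, ⟨hz, by simpa using hk⟩, rfl⟩
  refine measure_mono_null hcov (measure_iUnion_null fun k => ?_)
  set s := S ∩ ball (0 : EE n) k with hs
  rcases s.eq_empty_or_nonempty with h0 | hne
  · rw [h0]; simp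
  have hbt : μH[(n:ℝ)] (ball (0 : EE n) k) ≠ ⊤ := measure_ball_lt_top.ne
  set B := μH[(n:ℝ)] (ball (0 : EE n) k) with hB
  have key : ∀ ε : ℝ≥0, 0 < ε → ε ≤ 1 → μH[(n:ℝ)] (f '' s) ≤ (2 * K + 3) ^ n * (ε * B) := by
    intro ε hε hε1
    obtain ⟨t, A, htd, htm, htc, htA, hAy⟩ := exists_partition_approximatesLinearOn_of_hasFDerivWithinAt
      f s (fderiv ℝ f) (fun x hx => hx.1.1.hasFDerivAt.hasFDerivWithinAt) (fun _ => ε) (fun _ => hε.ne')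
    have hpiece : ∀ j, μH[(n:ℝ)] (f '' (s ∩ t j)) ≤ (2 * K + 3) ^ n * (ε * μH[(n:ℝ)] (ball 0 k ∩ t j)) := by
      intro j
      obtain ⟨y, hy, hAj⟩ := hAy hne j
      have hnI := hy.1.2
      rw [← hAj] at hnI
      have : ∃ u, u ≠ 0 ∧ A j u = 0 := by
        by_contra hcon
        push Not at hcon
        apply hnI
        rw [injective_iff_map_eq_zero]
        intro a ha
        by_contra ha0
        exact hcon a ha0 ha
      obtain ⟨u, hu0, hu⟩ := this
      have hAK : ‖A j‖ ≤ K := by rw [hAj]; exact norm_fderiv_le_of_lipschitz ℝ hf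
      refine (degenerate_piece f K (A j) hAK (‖u‖⁻¹ • u) ?_ ?_ ε hε hε1 _ (htA j)).trans ?_
      · rw [norm_smul, norm_inv, norm_norm, inv_mul_cancel₀ (norm_ne_zero_iff.2 hu0)]
      · rw [map_smul, hu, smul_zero]
      · gcongr
        exact inter_subset_right
    calc μH[(n:ℝ)] (f '' s) ≤ μH[(n:ℝ)] (⋃ j, f '' (s ∩ t j)) := by
          refine measure_mono ?_
          rintro _ ⟨x, hx, rfl⟩
          obtain ⟨j, hj⟩ := mem_iUnion.1 (htc hx)
          exact mem_iUnion.2 ⟨j, x, ⟨hx, hj⟩, rfl⟩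
      _ ≤ ∑' j, μH[(n:ℝ)] (f '' (s ∩ t j)) := measure_iUnion_le _
      _ ≤ ∑' j, (2 * K + 3) ^ n * (ε * μH[(n:ℝ)] (ball 0 k ∩ t j)) := ENNReal.tsum_le_tsum hpiece
      _ = (2 * K + 3) ^ n * (ε * μH[(n:ℝ)] (⋃ j, ball 0 k ∩ t j)) := by
          rw [ENNReal.tsum_mul_left, ENNReal.tsum_mul_left, measure_iUnion]
          · exact fun i j hij => (htd hij).mono inter_subset_right inter_subset_right
          · exact fun j => measurableSet_ball.inter (htm j)
      _ ≤ _ := by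
          gcongr
          exact measure_mono (iUnion_subset fun j => inter_subset_left)
  by_contra hne0
  set Cc : ℝ≥0∞ := (2 * K + 3) ^ n * B with hCc
  have hCt : Cc ≠ ⊤ := by finiteness
  have htend : Filter.Tendsto (fun ε : ℝ≥0 => (ε:ℝ≥0∞) * Cc) (nhdsWithin 0 (Ioi 0)) (nhds 0) := by
    have h1 : Filter.Tendsto (fun ε : ℝ≥0 => (ε:ℝ≥0∞)) (nhdsWithin 0 (Ioi 0)) (nhds 0) :=
      (ENNReal.continuous_coe.tendsto 0).mono_left nhdsWithin_le_nhds
    have := ENNReal.Tendsto.mul_const (b := Cc) h1 (Or.inr hCt)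
    simpa using this
  have hev := (htend.eventually_lt_const (pos_iff_ne_zero.2 hne0)).and (Ioo_mem_nhdsGT (one_pos))
  obtain ⟨ε, h1, h2⟩ := hev.exists
  have h3 := key ε h2.1 h2.2.le
  rw [show (2 * (K:ℝ≥0∞) + 3) ^ n * (ε * B) = ε * Cc by rw [hCc]; ring] at h3
  exact absurd h1 (not_lt.2 h3)

lemma hausdorff_eq_smul (n : ℕ) : ∃ c : ℝ≥0, (μH[(n:ℝ)] : Measure (EE n)) = c • (volume : Measure (EE n)) :=
  ⟨_, Measure.isAddLeftInvariant_eq_smul (μH[(n:ℝ)] : Measure (EE n)) volume⟩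

lemma lint_param {n d : ℕ} (P : EE n → EE d) (Λ : ℝ≥0) (hP : LipschitzWith Λ P) (U : Set (EE n))
    (_hU : MeasurableSet U) (S : Set (EE d)) (hS : S ⊆ P '' U) (G : EE d → ℝ≥0∞) (hG : Measurable G) :
    ∫⁻ y in S, G y ∂μH[(n:ℝ)] ≤ Λ ^ n * ∫⁻ v in U, G (P v) ∂μH[(n:ℝ)] := by
  have hPm : Measurable P := hP.continuous.measurable
  have hle : (μH[(n:ℝ)] : Measure (EE d)).restrict S ≤
      ((Λ:ℝ≥0∞) ^ n) • ((μH[(n:ℝ)] : Measure (EE n)).restrict U).map P := by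
    rw [Measure.le_iff]
    intro s hs
    rw [Measure.restrict_apply hs, Measure.smul_apply, Measure.map_apply hPm hs,
      Measure.restrict_apply (hPm hs), smul_eq_mul]
    calc μH[(n:ℝ)] (s ∩ S) ≤ μH[(n:ℝ)] (P '' (P ⁻¹' s ∩ U)) := by
          refine measure_mono ?_
          rintro y ⟨hy, hyS⟩
          obtain ⟨v, hv, rfl⟩ := hS hyS
          exact ⟨v, ⟨hy, hv⟩, rfl⟩
      _ ≤ _ := by
          have := hP.hausdorffMeasure_image_le (d := (n:ℝ)) (by positivity) (P ⁻¹' s ∩ U)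
          rwa [ENNReal.rpow_natCast] at this
  refine (lintegral_mono' hle le_rfl).trans ?_
  rw [lintegral_smul_measure, lintegral_map hG hPm, smul_eq_mul]

lemma infEDist_msupport_meas {d : ℕ} (μ : Measure (EE d)) : Measurable fun y => infEDist y (msupport μ) ^ 2 :=
  measurable_infEDist.pow_const 2

lemma bbeta_le {n d : ℕ} (μ : Measure (EE d)) (x : EE d) (r : ℝ) (hr : 0 < r)
    (a : EE d) (T : EE n →L[ℝ] EE d) (hT : Function.Injective T) :
    bbeta2sq n μ x r ≤ (ENNReal.ofReal r ^ (n + 2))⁻¹ *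
      ((∫⁻ y in ball x r, infEDist y (range fun u => a + T u) ^ 2 ∂μ) +
       ∫⁻ y in ball x r ∩ (range fun u => a + T u), infEDist y (msupport μ) ^ 2 ∂μH[(n:ℝ)]) := by
  set L : AffineSubspace ℝ (EE d) := AffineSubspace.mk' a (LinearMap.range (T : EE n →ₗ[ℝ] EE d)) with hL
  have hLp : IsPlane n L := by
    unfold IsPlane
    rw [hL, AffineSubspace.direction_mk', LinearMap.finrank_range_of_inj (by exact hT)]
    simp
  have hLr : (L : Set (EE d)) = range fun u => a + T u := by
    ext y
    rw [hL, SetLike.mem_coe, AffineSubspace.mem_mk']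
    simp only [LinearMap.mem_range, mem_range, vsub_eq_sub]
    constructor
    · rintro ⟨u, hu⟩
      refine ⟨u, ?_⟩
      have hu' : T u = y - a := hu
      rw [hu']; abel
    · rintro ⟨u, rfl⟩
      exact ⟨u, by simp⟩
  unfold bbeta2sq
  refine (iInf₂_le L hLp).trans ?_
  rw [hLr]
  have hR0 : ENNReal.ofReal r ≠ 0 := by simpa using hr
  have e : ∀ b : ℝ≥0∞, (b / ENNReal.ofReal r) ^ 2 = b ^ 2 * (ENNReal.ofReal r ^ 2)⁻¹ := by
    intro b
    rw [div_eq_mul_inv, mul_pow, ENNReal.inv_pow]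
  have hRi : (ENNReal.ofReal r ^ 2)⁻¹ ≠ ⊤ := by simpa using hr
  simp only [e]
  rw [lintegral_mul_const' _ _ hRi, lintegral_mul_const' _ _ hRi, ← add_mul, pow_add,
    ENNReal.mul_inv (Or.inl (pow_ne_zero _ hR0)) (Or.inl (by simp))]
  refine le_of_eq ?_
  change _ * (((∫⁻ y in ball x r, infEDist y (range fun u => a + T u) ^ 2 ∂μ) +
       ∫⁻ y in ball x r ∩ (range fun u => a + T u), infEDist y (msupport μ) ^ 2 ∂μH[(n:ℝ)]) * _) = _
  ring

lemma dyadic_cov : Ioo (0:ℝ) 1 ⊆ ⋃ j : ℕ, Ioc ((2:ℝ)⁻¹ ^ (j+1)) ((2:ℝ)⁻¹ ^ j) := by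
  rintro r ⟨hr0, hr1⟩
  obtain ⟨j, hj⟩ := exists_nat_pow_near_of_lt_one hr0 hr1.le (y := (2:ℝ)⁻¹) (by norm_num) (by norm_num)
  exact mem_iUnion.2 ⟨j, hj⟩

lemma dyadic_piece (b : ℝ → ℝ≥0∞) (p : ℝ) (hp : 0 < p) (B : ℝ≥0∞) (hB : ∀ r ∈ Ioc p (2*p), b r ≤ B) :
    ∫⁻ r in Ioc p (2*p), b r / ENNReal.ofReal r ≤ B := by
  calc ∫⁻ r in Ioc p (2*p), b r / ENNReal.ofReal r ≤ ∫⁻ r in Ioc p (2*p), B / ENNReal.ofReal p := by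
        refine setLIntegral_mono' measurableSet_Ioc fun r hr => ?_
        exact ENNReal.div_le_div (hB r hr) (ENNReal.ofReal_le_ofReal hr.1.le)
    _ = B / ENNReal.ofReal p * ENNReal.ofReal p := by
        have e : 2 * p - p = p := by ring
        rw [setLIntegral_const, Real.volume_Ioc, e]
    _ ≤ B := by
        rw [ENNReal.div_mul_cancel (by simpa using hp) ENNReal.ofReal_ne_top]

lemma tsum_split_lt (u β C : ℕ → ℝ≥0∞) (j0 : ℕ) (h1 : ∀ j, u j ≤ C j) (hC : ∀ j, C j ≠ ⊤)
    (h2 : ∀ j ≥ j0, u j ≤ β j) (h3 : ∑' j, β j < ⊤) : ∑' j, u j < ⊤ := by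
  have hu := Summable.sum_add_tsum_nat_add' (f := u) (k := j0) ENNReal.summable
  have hβ := Summable.sum_add_tsum_nat_add' (f := β) (k := j0) ENNReal.summable
  rw [← hu]
  refine ENNReal.add_lt_top.2 ⟨?_, ?_⟩
  · refine ENNReal.sum_lt_top.2 fun j _ => ?_
    exact (h1 j).trans_lt (hC j).lt_top
  · refine lt_of_le_of_lt (ENNReal.tsum_le_tsum fun j => h2 (j + j0) (by omega)) ?_
    refine lt_of_le_of_lt ?_ h3
    rw [← hβ]
    exact le_add_self

lemma dyadic_sum (b : ℝ → ℝ≥0∞) (β : ℕ → ℝ≥0∞) (j0 : ℕ)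
    (h1 : ∀ j : ℕ, ∃ C : ℝ≥0∞, C ≠ ⊤ ∧ ∀ r ∈ Ioc ((2:ℝ)⁻¹ ^ (j+1)) ((2:ℝ)⁻¹ ^ j), b r ≤ C)
    (h2 : ∀ j ≥ j0, ∀ r ∈ Ioc ((2:ℝ)⁻¹ ^ (j+1)) ((2:ℝ)⁻¹ ^ j), b r ≤ β j)
    (h3 : ∑' j, β j < ⊤) :
    ∫⁻ r in Ioo (0:ℝ) 1, b r / ENNReal.ofReal r < ⊤ := by
  choose C hCt hC using h1
  have e : ∀ j : ℕ, (2:ℝ)⁻¹^j = 2 * (2:ℝ)⁻¹^(j+1) := by intro j; rw [pow_succ]; ring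
  have key : ∀ (j : ℕ) (B : ℝ≥0∞), (∀ r ∈ Ioc ((2:ℝ)⁻¹ ^ (j+1)) ((2:ℝ)⁻¹ ^ j), b r ≤ B) →
      ∫⁻ r in Ioc ((2:ℝ)⁻¹ ^ (j+1)) ((2:ℝ)⁻¹ ^ j), b r / ENNReal.ofReal r ≤ B := by
    intro j B hB
    rw [e j] at hB ⊢
    exact dyadic_piece b _ (by positivity) B hB
  refine lt_of_le_of_lt ((lintegral_mono_set dyadic_cov).trans (lintegral_iUnion_le _ _)) ?_
  exact tsum_split_lt _ β C j0 (fun j => key j _ (hC j)) hCt (fun j hj => key j _ (h2 j hj)) h3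

lemma le_mul_infEDist {Y : Type*} [PseudoEMetricSpace Y] (y : Y) (S : Set Y) (a c : ℝ≥0∞) (hc0 : c ≠ 0)
    (hct : c ≠ ⊤) (h : ∀ w ∈ S, a ≤ c * edist y w) : a ≤ c * infEDist y S := by
  rw [mul_comm, ← ENNReal.div_le_iff hc0 hct]
  refine le_infEDist.2 fun w hw => ?_
  rw [ENNReal.div_le_iff hc0 hct, mul_comm]
  exact h w hw

lemma term1 {n d : ℕ} (μ : Measure (EE d)) (N : ℝ) [IsFiniteMeasure (μ.restrict (ball 0 N))]
    (f : EE n → EE d) (K : ℝ≥0) (hf : LipschitzWith K f)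
    (q : EE d → EE n) (Q : ℝ≥0) (hq : LipschitzWith Q q) (Z : Set (EE n)) (hqf : ∀ z ∈ closure Z, q (f z) = z)
    (M : ℝ≥0∞) (hM : ∀ z ∈ Z, ∀ r, 0 < r →
      (μ.restrict (ball 0 N)).map q (closedBall z r) ≤ M * ENNReal.ofReal r ^ n)
    (P : EE n → EE d) (Λ : ℝ≥0) (hh : LipschitzWith Λ fun v => f v - P v)
    (z : EE n) (hz : z ∈ closure Z) (r δ A : ℝ) (hr : r ≤ δ) (hδ : 0 < δ) (hA : (Q:ℝ) + 1 ≤ A)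
    (hN : ball (f z) δ ⊆ ball 0 N) :
    ∫⁻ y in ball (f z) r, infEDist y (range P) ^ 2 ∂μ ≤
      2 * ((1 + K * Q)^2 * (∫⁻ y in ball (f z) δ, infEDist y (f '' closure Z)^2 ∂(μ.restrict (ball 0 N)))
      + (2*9^n*(volume (ball (0:EE n) 1))⁻¹*M * (∫⁻ v in ball z (2*(A*δ)), ‖f v - P v‖ₑ^2)
        + 2*Λ^2*∫⁻ w in ball z (2*(A*δ)), infEDist w (closure Z)^2 ∂((μ.restrict (ball 0 N)).map q))) := by
  have hQ0 : (0:ℝ) ≤ Q := Q.2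
  have hqm : Measurable q := hq.continuous.measurable
  have hhm : Measurable fun v => ‖f v - P v‖ₑ ^ 2 := by
    have := hh.continuous.measurable
    exact (this.enorm).pow_const 2
  have p1 : ∀ y, edist y (f (q y)) ≤ (1 + K * Q) * infEDist y (f '' closure Z) := by
    intro y
    have hct : (1 + K * Q : ℝ≥0∞) ≠ ⊤ := by
      exact_mod_cast (ENNReal.coe_ne_top : ((1 + K * Q : ℝ≥0) : ℝ≥0∞) ≠ ⊤)
    refine le_mul_infEDist _ _ _ _ (by simp) hct ?_
    rintro _ ⟨w, hw, rfl⟩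
    calc edist y (f (q y)) ≤ edist y (f w) + edist (f w) (f (q y)) := edist_triangle _ _ _
      _ ≤ edist y (f w) + K * (Q * edist (f w) y) := by
          gcongr
          refine (hf _ _).trans ?_
          gcongr
          conv_lhs => rw [← hqf w hw]
          exact hq _ _
      _ = _ := by rw [edist_comm (f w) y]; ring
  have p2 : ∀ y, infEDist y (range P) ^ 2 ≤ 2 * ((1 + K * Q)^2 * infEDist y (f '' closure Z) ^ 2 +
      ‖f (q y) - P (q y)‖ₑ ^ 2) := by
    intro y
    have : infEDist y (range P) ≤ (1 + K * Q) * infEDist y (f '' closure Z) + ‖f (q y) - P (q y)‖ₑ := by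
      refine (infEDist_le_edist_of_mem (mem_range_self (q y))).trans ?_
      refine (edist_triangle y (f (q y)) _).trans ?_
      rw [edist_eq_enorm_sub (f (q y))]
      gcongr
      exact p1 y
    calc infEDist y (range P) ^ 2 ≤ ((1 + K * Q) * infEDist y (f '' closure Z) + ‖f (q y) - P (q y)‖ₑ)^2 := by
          gcongr
      _ ≤ _ := add_sq_le_enn _ _
      _ = _ := by rw [mul_pow]
  have hres : (μ.restrict (ball 0 N)).restrict (ball (f z) δ) = μ.restrict (ball (f z) δ) := by
    rw [Measure.restrict_restrict measurableSet_ball, inter_eq_left.2 hN]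
  have hm1 : Measurable fun y => (1 + K * Q : ℝ≥0∞)^2 * infEDist y (f '' closure Z) ^ 2 :=
    (measurable_infEDist.pow_const 2).const_mul _
  have hct2 : ((1 + K * Q : ℝ≥0∞))^2 ≠ ⊤ := by
    exact_mod_cast (ENNReal.coe_ne_top : (((1 + K * Q)^2 : ℝ≥0) : ℝ≥0∞) ≠ ⊤)
  have p3 : ∫⁻ y in ball (f z) δ, ‖f (q y) - P (q y)‖ₑ ^ 2 ∂(μ.restrict (ball 0 N)) ≤
      ∫⁻ w in ball z (A*δ), ‖f w - P w‖ₑ^2 ∂((μ.restrict (ball 0 N)).map q) := by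
    rw [setLIntegral_map measurableSet_ball hhm hqm]
    refine lintegral_mono_set ?_
    intro y hy
    rw [mem_preimage, mem_ball]
    rw [mem_ball] at hy
    calc dist (q y) z = dist (q y) (q (f z)) := by rw [hqf z hz]
      _ ≤ Q * dist y (f z) := hq.dist_le_mul _ _
      _ ≤ Q * δ := by gcongr
      _ < A * δ := by
          refine mul_lt_mul_of_pos_right (by linarith) hδ
  have p4 := lemmaS ((μ.restrict (ball 0 N)).map q) Z M hM (fun v => f v - P v) Λ hh z hz (A*δ)
    (by have : 0 < A := by linarith
        positivity)
  calc ∫⁻ y in ball (f z) r, infEDist y (range P) ^ 2 ∂μ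
      ≤ ∫⁻ y in ball (f z) δ, infEDist y (range P) ^ 2 ∂μ := lintegral_mono_set (ball_subset_ball hr)
    _ ≤ ∫⁻ y in ball (f z) δ, 2 * ((1 + K * Q)^2 * infEDist y (f '' closure Z) ^ 2 +
      ‖f (q y) - P (q y)‖ₑ ^ 2) ∂μ := lintegral_mono p2
    _ = 2 * ((1 + K * Q)^2 * (∫⁻ y in ball (f z) δ, infEDist y (f '' closure Z)^2 ∂(μ.restrict (ball 0 N)))
        + ∫⁻ y in ball (f z) δ, ‖f (q y) - P (q y)‖ₑ ^ 2 ∂(μ.restrict (ball 0 N))) := by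
      rw [hres, lintegral_const_mul' _ _ (by simp), lintegral_add_left hm1,
        lintegral_const_mul' _ _ hct2]
    _ ≤ _ := by
      gcongr
      refine p3.trans (p4.trans ?_)
      simp only [infEDist_closure]
      refine add_le_add le_rfl (mul_le_mul' le_rfl (lintegral_mono_set (ball_subset_ball ?_)))
      have : 0 < A := by linarith
      have : 0 < A * δ := by positivity
      linarith

lemma term2 {n d : ℕ} (S : Set (EE d)) (f : EE n → EE d) (K : ℝ≥0) (hf : LipschitzWith K f)
    (Z : Set (EE n)) (hZn : Z.Nonempty) (hZ : f '' Z ⊆ S) (P : EE n → EE d) (Λ : ℝ≥0) (hP : LipschitzWith Λ P)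
    (z : EE n) (x : EE d) (r σ : ℝ) (hσ : ∀ v, P v ∈ ball x r → v ∈ ball z σ)
    (cH : ℝ≥0) (hcH : (μH[(n:ℝ)] : Measure (EE n)) = cH • (volume : Measure (EE n))) :
    ∫⁻ y in ball x r ∩ range P, infEDist y S ^ 2 ∂μH[(n:ℝ)] ≤
      Λ ^ n * (cH * (2 * ((∫⁻ v in ball z σ, ‖f v - P v‖ₑ^2) + K ^ 2 * ∫⁻ v in ball z σ, infEDist v Z ^ 2))) := by
  refine (lint_param P Λ hP (ball z σ) measurableSet_ball _ ?_ (fun y => infEDist y S ^ 2)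
    (measurable_infEDist.pow_const 2)).trans ?_
  · rintro _ ⟨hy, v, rfl⟩
    exact ⟨v, hσ v hy, rfl⟩
  have hhm : Measurable fun v => ‖f v - P v‖ₑ ^ 2 := by
    have := (hf.continuous.sub hP.continuous).measurable
    exact (this.enorm).pow_const 2
  have p1 : ∀ v, infEDist (f v) S ≤ K * infEDist v Z := by
    intro v
    by_cases hK : K = 0
    · obtain ⟨w, hw⟩ := hZn
      refine (infEDist_le_edist_of_mem (hZ ⟨w, hw, rfl⟩)).trans ((hf _ _).trans ?_)
      simp [hK]
    refine le_mul_infEDist _ _ _ _ (by simpa using hK) (by simp) fun w hw => ?_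
    exact (infEDist_le_edist_of_mem (hZ ⟨w, hw, rfl⟩)).trans (hf _ _)
  have p2 : ∀ v, infEDist (P v) S ^ 2 ≤ 2 * (‖f v - P v‖ₑ^2 + K^2 * infEDist v Z ^ 2) := by
    intro v
    rw [← mul_pow]
    refine le_trans ?_ (add_sq_le_enn _ _)
    gcongr
    refine (infEDist_le_edist_add_infEDist (y := f v)).trans ?_
    rw [edist_comm, edist_eq_enorm_sub]
    gcongr
    exact p1 v
  gcongr
  rw [hcH]
  have : ∀ G : EE n → ℝ≥0∞, ∫⁻ v in ball z σ, G v ∂(cH • (volume : Measure (EE n))) =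
      cH * ∫⁻ v in ball z σ, G v := by
    intro G
    rw [Measure.restrict_smul]
    exact lintegral_smul_measure _ _
  rw [this]
  gcongr
  refine (lintegral_mono p2).trans ?_
  rw [lintegral_const_mul' _ _ (by simp), lintegral_add_left hhm,
        lintegral_const_mul' _ _ (by simp)]

lemma ofReal_half_pow (j : ℕ) : ENNReal.ofReal ((2:ℝ)⁻¹ ^ j) = ((2:ℝ≥0∞)⁻¹) ^ j := by
  rw [ENNReal.ofReal_pow (by norm_num), ENNReal.ofReal_inv_of_pos (by norm_num)]
  simp

lemma half_pow_inv (m j : ℕ) : (((2:ℝ≥0∞)⁻¹ ^ (j+1)) ^ m)⁻¹ = 2 ^ m * (2 ^ m) ^ j := by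
  rw [← ENNReal.inv_pow, ← ENNReal.inv_pow, inv_inv, ← pow_mul, ← pow_mul, ← pow_add]
  congr 1; ring

lemma two_pow_half (n j : ℕ) : ((2:ℝ≥0∞)^(n+2))^j * ((2:ℝ≥0∞)⁻¹ ^ j)^n = 4 ^ j := by
  have h : (2:ℝ≥0∞) * 2⁻¹ = 1 := ENNReal.mul_inv_cancel (by simp) (by simp)
  calc ((2:ℝ≥0∞)^(n+2))^j * ((2:ℝ≥0∞)⁻¹ ^ j)^n = (2^2)^j * ((2 * 2⁻¹)^(n*j)) := by ring
    _ = 4^j := by rw [h]; norm_num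

lemma inv_radius (m j : ℕ) (r : ℝ) (hr : (2:ℝ)⁻¹^(j+1) ≤ r) :
    (ENNReal.ofReal r ^ m)⁻¹ ≤ 2 ^ m * (2 ^ m) ^ j := by
  rw [← half_pow_inv, ← ofReal_half_pow]
  gcongr

lemma combine (b p t k1 k2 k3 k4 X1 X2 X3 H L c C s W F B : ℝ≥0∞)
    (hb : b ≤ p * t * (2 * (k1 * X1 + (k2 * H + k3 * X2)) + L * (c * (2 * (H + k4 * X3)))))
    (hH : H ≤ C * (B * s) * W) (ht : t * s = F) :
    b ≤ (2*p*k1) * (t * X1) + (2*p*k3) * (t * X2) + (2*p*L*c*k4) * (t * X3)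
      + (2*p*(k2+L*c)*C*B) * (F * W) := by
  subst ht
  refine hb.trans ?_
  calc _ ≤ p * t * (2 * (k1 * X1 + (k2 * (C * (B * s) * W) + k3 * X2))
        + L * (c * (2 * ((C * (B * s) * W) + k4 * X3)))) := by gcongr
    _ = _ := by ring

lemma tsum_lt_four (x1 x2 x3 x4 : ℕ → ℝ≥0∞) (c1 c2 c3 c4 : ℝ≥0∞) (h1 : c1 ≠ ⊤) (h2 : c2 ≠ ⊤) (h3 : c3 ≠ ⊤)
    (h4 : c4 ≠ ⊤) (g1 : ∑' j, x1 j < ⊤) (g2 : ∑' j, x2 j < ⊤) (g3 : ∑' j, x3 j < ⊤) (g4 : ∑' j, x4 j < ⊤) :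
    ∑' j, (c1 * x1 j + c2 * x2 j + c3 * x3 j + c4 * x4 j) < ⊤ := by
  rw [ENNReal.tsum_add, ENNReal.tsum_add, ENNReal.tsum_add, ENNReal.tsum_mul_left, ENNReal.tsum_mul_left,
    ENNReal.tsum_mul_left, ENNReal.tsum_mul_left]
  refine ENNReal.add_lt_top.2 ⟨ENNReal.add_lt_top.2 ⟨ENNReal.add_lt_top.2 ⟨?_, ?_⟩, ?_⟩, ?_⟩
  · exact ENNReal.mul_lt_top h1.lt_top g1
  · exact ENNReal.mul_lt_top h2.lt_top g2
  · exact ENNReal.mul_lt_top h3.lt_top g3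
  · exact ENNReal.mul_lt_top h4.lt_top g4

lemma lower_pert {n d : ℕ} (T0 T : EE n →L[ℝ] EE d) (c : ℝ)
    (hT0 : ∀ u, c * ‖u‖ ≤ ‖T0 u‖) (hT : ‖T - T0‖ ≤ c/4) (hc : 0 < c) (u : EE n) : c/2 * ‖u‖ ≤ ‖T u‖ := by
  have h1 : ‖(T - T0) u‖ ≤ c/4 * ‖u‖ := ((T - T0).le_opNorm u).trans (by gcongr)
  have h2 : ‖T0 u‖ ≤ ‖T u‖ + ‖(T - T0) u‖ := by
    have : T0 u = T u - (T - T0) u := by simp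
    rw [this]; exact norm_sub_le _ _
  have := hT0 u
  have h3 : 0 ≤ c * ‖u‖ := by positivity
  linarith

lemma scale_bd {n d : ℕ} (μ : Measure (EE d)) (N : ℝ) [IsFiniteMeasure (μ.restrict (ball 0 N))]
    (f : EE n → EE d) (K : ℝ≥0) (hf : LipschitzWith K f)
    (q : EE d → EE n) (Q : ℝ≥0) (hq : LipschitzWith Q q) (Z : Set (EE n)) (hqf : ∀ z ∈ closure Z, q (f z) = z)
    (M : ℝ≥0∞) (hM : ∀ z ∈ Z, ∀ r, 0 < r →
      (μ.restrict (ball 0 N)).map q (closedBall z r) ≤ M * ENNReal.ofReal r ^ n)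
    (hS : f '' closure Z ⊆ msupport μ)
    (z : EE n) (hz : z ∈ closure Z) (hN : ball (f z) 1 ⊆ ball 0 N)
    (cH : ℝ≥0) (hcH : (μH[(n:ℝ)] : Measure (EE n)) = cH • (volume : Measure (EE n)))
    (T0 T : EE n →L[ℝ] EE d) (a : EE d) (c : ℝ) (hc : 0 < c) (hT0 : ∀ u, c * ‖u‖ ≤ ‖T0 u‖)
    (A : ℕ) (hA : (Q:ℝ) + 1 ≤ A) (hA2 : 2 / c ≤ A) (j : ℕ) (Λ : ℝ≥0) (hΛ : ‖T0‖ + c/4 ≤ Λ)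
    (ha : ‖a - f z‖ ≤ c/4 * (((2*A:ℕ):ℝ) * (2:ℝ)⁻¹^j)) (hT : ‖T - T0‖ ≤ c/4)
    (C : ℝ≥0)
    (hH : ∫⁻ v in ball z (((2*A:ℕ):ℝ) * (2:ℝ)⁻¹^j), ‖f v - (a + T (v - z))‖ₑ^2 ≤
      C * ENNReal.ofReal (((2*A:ℕ):ℝ) * (2:ℝ)⁻¹^j) ^ n * WW f z (((2*A:ℕ):ℝ) * (2:ℝ)⁻¹^j))
    (N' : ℝ) (hN' : ball z (((2*A:ℕ):ℝ)) ⊆ ball 0 N')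
    (r : ℝ) (hr : r ∈ Ioc ((2:ℝ)⁻¹ ^ (j+1)) ((2:ℝ)⁻¹ ^ j)) :
    bbeta2sq n μ (f z) r ≤
      (2*2^(n+2)*(1+K*Q)^2) * (((2:ℝ≥0∞)^(n+2))^j *
        ∫⁻ y in ball (f z) (1 * (2:ℝ)⁻¹^j), infEDist y (f '' closure Z)^2 ∂(μ.restrict (ball 0 N)))
      + (2*2^(n+2)*(2*(K+Λ:ℝ≥0)^2)) * (((2:ℝ≥0∞)^(n+2))^j *
        ∫⁻ w in ball z (((2*A:ℕ):ℝ) * (2:ℝ)⁻¹^j), infEDist w (closure Z)^2 ∂((μ.restrict (ball 0 N)).map q))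
      + (2*2^(n+2)*Λ^n*cH*K^2) * (((2:ℝ≥0∞)^(n+2))^j *
        ∫⁻ w in ball z (((2*A:ℕ):ℝ) * (2:ℝ)⁻¹^j), infEDist w (closure Z)^2 ∂(volume.restrict (ball 0 N')))
      + (2*2^(n+2)*(2*9^n*(volume (ball (0:EE n) 1))⁻¹*M+Λ^n*cH)*C*ENNReal.ofReal ((2*A:ℕ):ℝ)^n) *
        (4^j * WW f z (((2*A:ℕ):ℝ) * (2:ℝ)⁻¹^j)) := by
  have hQ0 : (0:ℝ) ≤ Q := Q.2
  have hA0 : (0:ℝ) < A := by linarith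
  set δ : ℝ := (2:ℝ)⁻¹^j with hδ
  have hδ0 : 0 < δ := by positivity
  have hδ1 : δ ≤ 1 := pow_le_one₀ (by norm_num) (by norm_num)
  have hcast : ((2*A:ℕ):ℝ) = 2 * A := by push_cast; ring
  set σ : ℝ := ((2*A:ℕ):ℝ) * δ with hσ
  have hσ' : σ = 2 * (A * δ) := by rw [hσ, hcast]; ring
  have hr0 : 0 < r := lt_trans (by positivity) hr.1
  have hlow := lower_pert T0 T c hT0 hT hc
  have hinj : Function.Injective T := by
    rw [injective_iff_map_eq_zero]
    intro u hu
    have := hlow u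
    rw [hu, norm_zero] at this
    have h0 : ‖u‖ ≤ 0 := by
      by_contra hcon
      push Not at hcon
      have : 0 < c/2 * ‖u‖ := by positivity
      linarith
    exact norm_le_zero_iff.1 h0
  set P : EE n → EE d := fun u => (a - T z) + T u with hP
  have hPe : ∀ v, a + T (v - z) = P v := by
    intro v; simp only [hP, map_sub]; abel
  have hTn : ‖T‖ ≤ Λ := by
    have : T = T0 + (T - T0) := by abel
    calc ‖T‖ ≤ ‖T0‖ + ‖T - T0‖ := by
          conv_lhs => rw [this]
          exact norm_add_le _ _
      _ ≤ _ := by linarith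
  have hPL : LipschitzWith Λ P := by
    refine LipschitzWith.of_dist_le_mul fun u v => ?_
    simp only [hP, dist_add_left]
    rw [dist_eq_norm, dist_eq_norm, ← map_sub]
    exact (T.le_opNorm _).trans (by gcongr)
  have hhL : LipschitzWith (K + Λ) fun v => f v - P v := hf.sub hPL
  simp only [hPe] at hH
  have hball : ∀ v, P v ∈ ball (f z) r → v ∈ ball z σ := by
    intro v hv
    rw [mem_ball, dist_eq_norm] at hv ⊢
    have e : T (v - z) = (P v - f z) - (a - f z) := by rw [← hPe]; abel
    have h1 : ‖T (v - z)‖ ≤ ‖P v - f z‖ + ‖a - f z‖ := by rw [e]; exact norm_sub_le _ _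
    have h2 := hlow (v - z)
    have h3 : c/2 * ‖v - z‖ < δ + c/4 * σ := by linarith [hr.2]
    have h4 : 2 ≤ A * c := by rwa [div_le_iff₀ hc] at hA2
    have h5 : 2 * δ ≤ A * c * δ := by gcongr
    rw [hσ'] at h3 ⊢
    by_contra hcon
    push Not at hcon
    have h6 : c/2 * (2 * (A * δ)) ≤ c/2 * ‖v - z‖ := by gcongr
    nlinarith
  have hNδ : ball (f z) δ ⊆ ball 0 N := (ball_subset_ball hδ1).trans hN
  have t1 := term1 μ N f K hf q Q hq Z hqf M hM P (K + Λ) hhL z hz r δ A hr.2 hδ0 hA hNδ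
  have t2 := term2 (msupport μ) f K hf (closure Z) ⟨z, hz⟩ hS P Λ hPL z (f z) r σ hball cH hcH
  have b1 := bbeta_le (n := n) μ (f z) r hr0 (a - T z) T hinj
  rw [← hσ'] at t1
  have hv : (volume.restrict (ball 0 N')).restrict (ball z σ) = (volume : Measure (EE n)).restrict (ball z σ) := by
    rw [Measure.restrict_restrict measurableSet_ball, inter_eq_left.2]
    refine (ball_subset_ball ?_).trans hN'
    rw [hσ]
    exact mul_le_of_le_one_right (by positivity) hδ1
  rw [hv, one_mul]
  have hs : ENNReal.ofReal σ ^ n = ENNReal.ofReal ((2*A:ℕ):ℝ)^n * ((2:ℝ≥0∞)⁻¹ ^ j)^n := by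
    rw [hσ, ENNReal.ofReal_mul (by positivity), mul_pow, hδ, ofReal_half_pow]
  rw [hs] at hH
  refine combine _ _ _ _ _ _ _ _ _ _ _ _ _ _ _ _ _ _ ?_ hH (two_pow_half n j)
  refine b1.trans ?_
  refine mul_le_mul' (inv_radius _ _ _ hr.1.le) ?_
  exact add_le_add t1 t2

lemma trivial_bd {n d : ℕ} (μ : Measure (EE d)) (x : EE d) (hx : x ∈ msupport μ) (hfin : μ (ball x 1) ≠ ⊤)
    (T0 : EE n →L[ℝ] EE d) (c : ℝ) (hc : 0 < c) (hT0 : ∀ u, c * ‖u‖ ≤ ‖T0 u‖) (hinj : Function.Injective T0)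
    (j : ℕ) : ∃ C : ℝ≥0∞, C ≠ ⊤ ∧ ∀ r ∈ Ioc ((2:ℝ)⁻¹ ^ (j+1)) ((2:ℝ)⁻¹ ^ j), bbeta2sq n μ x r ≤ C := by
  obtain ⟨cH, hcH⟩ := hausdorff_eq_smul n
  refine ⟨2 ^ (n+2) * (2 ^ (n+2)) ^ j * (μ (ball x 1) + (‖T0‖₊:ℝ≥0∞) ^ n * (cH * volume (ball (0:EE n) c⁻¹))), ?_, ?_⟩
  · have h1 : volume (ball (0:EE n) c⁻¹) ≠ ⊤ := measure_ball_lt_top.ne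
    finiteness
  intro r hr
  have hr0 : 0 < r := lt_trans (by positivity) hr.1
  have hr1 : r ≤ 1 := hr.2.trans (pow_le_one₀ (by norm_num) (by norm_num))
  have b1 := bbeta_le (n := n) μ x r hr0 x T0 hinj
  refine b1.trans (mul_le_mul' (inv_radius _ _ _ hr.1.le) ?_)
  have key : ∀ (S : Set (EE d)), x ∈ S → ∀ y ∈ ball x r, infEDist y S ^ 2 ≤ 1 := by
    intro S hS y hy
    refine pow_le_one₀ zero_le ?_
    refine (infEDist_le_edist_of_mem hS).trans ?_
    rw [edist_dist, ENNReal.ofReal_le_one]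
    exact (mem_ball.1 hy).le.trans hr1
  refine add_le_add ?_ ?_
  · calc ∫⁻ y in ball x r, infEDist y (range fun u => x + T0 u) ^ 2 ∂μ ≤ ∫⁻ y in ball x r, 1 ∂μ :=
          setLIntegral_mono' measurableSet_ball (key _ ⟨0, by simp⟩)
      _ = μ (ball x r) := by simp
      _ ≤ _ := measure_mono (ball_subset_ball hr1)
  · have hPL : LipschitzWith ‖T0‖₊ (fun u => x + T0 u) := by
      refine LipschitzWith.of_dist_le_mul fun u v => ?_
      simp only [dist_add_left]
      rw [dist_eq_norm, dist_eq_norm, ← map_sub]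
      exact T0.le_opNorm _
    calc ∫⁻ y in ball x r ∩ (range fun u => x + T0 u), infEDist y (msupport μ) ^ 2 ∂μH[(n:ℝ)]
        ≤ ∫⁻ y in ball x r ∩ (range fun u => x + T0 u), 1 ∂μH[(n:ℝ)] := by
          rw [← Measure.restrict_restrict measurableSet_ball]
          exact setLIntegral_mono' measurableSet_ball (key _ hx)
      _ ≤ (‖T0‖₊:ℝ≥0∞) ^ n * ∫⁻ v in ball (0:EE n) c⁻¹, 1 ∂μH[(n:ℝ)] := by
          refine lint_param (fun u => x + T0 u) ‖T0‖₊ hPL _ measurableSet_ball _ ?_ _ measurable_const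
          rintro _ ⟨hy, u, rfl⟩
          refine ⟨u, ?_, rfl⟩
          rw [mem_ball, dist_eq_norm] at hy ⊢
          simp only [add_sub_cancel_left] at hy
          rw [sub_zero, inv_eq_one_div, lt_div_iff₀ hc, mul_comm]
          exact (hT0 u).trans_lt (hy.trans_le hr1)
      _ = _ := by
          rw [hcH]
          simp

lemma pointwise {n d : ℕ} (μ : Measure (EE d)) (N : ℝ) [IsFiniteMeasure (μ.restrict (ball 0 N))]
    (f : EE n → EE d) (K : ℝ≥0) (hf : LipschitzWith K f)
    (q : EE d → EE n) (Q : ℝ≥0) (hq : LipschitzWith Q q) (Z : Set (EE n)) (hqf : ∀ z ∈ closure Z, q (f z) = z)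
    (M : ℝ≥0∞) (hMt : M ≠ ⊤) (hM : ∀ z ∈ Z, ∀ r, 0 < r →
      (μ.restrict (ball 0 N)).map q (closedBall z r) ≤ M * ENNReal.ofReal r ^ n)
    (hS : f '' closure Z ⊆ msupport μ)
    (z : EE n) (hz : z ∈ closure Z) (hN : ball (f z) 1 ⊆ ball 0 N)
    (T0 : EE n →L[ℝ] EE d) (hd : HasFDerivAt f T0 z) (hinj : Function.Injective T0)
    (g1 : ∑' j : ℕ, ((2:ℝ≥0∞)^(n+2))^j *
        ∫⁻ y in ball (f z) (1 * (2:ℝ)⁻¹^j), infEDist y (f '' closure Z)^2 ∂(μ.restrict (ball 0 N)) < ⊤)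
    (g2 : ∀ A : ℕ, 0 < A → ∑' j : ℕ, ((2:ℝ≥0∞)^(n+2))^j *
        ∫⁻ w in ball z ((A:ℝ) * (2:ℝ)⁻¹^j), infEDist w (closure Z)^2 ∂((μ.restrict (ball 0 N)).map q) < ⊤)
    (g3 : ∀ A : ℕ, 0 < A → ∀ N' : ℕ, ∑' j : ℕ, ((2:ℝ≥0∞)^(n+2))^j *
        ∫⁻ w in ball z ((A:ℝ) * (2:ℝ)⁻¹^j), infEDist w (closure Z)^2 ∂(volume.restrict (ball 0 (N':ℝ))) < ⊤)
    (g4 : ∀ A : ℕ, 0 < A → ∑' j : ℕ, (4:ℝ≥0∞)^j * WW f z ((A:ℝ) * (2:ℝ)⁻¹^j) < ⊤) :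
    ∫⁻ r in Ioo (0:ℝ) 1, bbeta2sq n μ (f z) r / ENNReal.ofReal r < ⊤ := by
  obtain ⟨cH, hcH⟩ := hausdorff_eq_smul n
  obtain ⟨k, hk0, hk⟩ := (T0 : EE n →ₗ[ℝ] EE d).exists_antilipschitzWith (LinearMap.ker_eq_bot.2 hinj)
  have hk0' : (0:ℝ) < k := hk0
  obtain ⟨c, hc, hT0⟩ : ∃ c : ℝ, 0 < c ∧ ∀ u, c * ‖u‖ ≤ ‖T0 u‖ := by
    refine ⟨(k:ℝ)⁻¹, by positivity, fun u => ?_⟩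
    have := hk.le_mul_dist u 0
    simp only [dist_zero_right, map_zero] at this
    rw [inv_mul_le_iff₀ hk0']
    exact this
  obtain ⟨A, hA⟩ := exists_nat_ge (max ((Q:ℝ) + 1) (2/c))
  have hA1 : (Q:ℝ) + 1 ≤ A := (le_max_left _ _).trans hA
  have hA2 : 2/c ≤ A := (le_max_right _ _).trans hA
  have hQ0 : (0:ℝ) ≤ Q := Q.2
  have hA0 : (0:ℝ) < A := by linarith
  have hAn : 0 < 2 * A := by
    have : 0 < A := by exact_mod_cast hA0
    omega
  have hAr : (0:ℝ) < ((2*A:ℕ):ℝ) := by exact_mod_cast hAn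
  obtain ⟨N', hN'⟩ := exists_nat_ge (‖z‖ + ((2*A:ℕ):ℝ))
  obtain ⟨C, hC⟩ := local_affine n d
  obtain ⟨ρ0, hρ0, hloc⟩ := hC f hf.continuous z T0 hd (c/4) (by positivity)
  obtain ⟨j0, hj0⟩ : ∃ j0 : ℕ, ∀ j ≥ j0, ((2*A:ℕ):ℝ) * (2:ℝ)⁻¹^j < ρ0 := by
    obtain ⟨j0, hj0⟩ := exists_pow_lt_of_lt_one (div_pos hρ0 hAr) (y := (2:ℝ)⁻¹) (by norm_num)
    refine ⟨j0, fun j hj => ?_⟩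
    have h1 : (2:ℝ)⁻¹^j ≤ (2:ℝ)⁻¹^j0 := pow_le_pow_of_le_one (by norm_num) (by norm_num) hj
    have := h1.trans_lt hj0
    rwa [lt_div_iff₀ hAr, mul_comm] at this
  have hxs : f z ∈ msupport μ := hS ⟨z, hz, rfl⟩
  have hfin : μ (ball (f z) 1) ≠ ⊤ := by
    have h1 : μ (ball (f z) 1) ≤ μ.restrict (ball 0 N) univ := by
      rw [Measure.restrict_apply_univ]; exact measure_mono hN
    exact (h1.trans_lt (measure_lt_top _ _)).ne
  have hv0 : (volume (ball (0:EE n) 1))⁻¹ ≠ ⊤ := by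
    rw [Ne, ENNReal.inv_eq_top]
    exact (measure_ball_pos _ _ one_pos).ne'
  obtain ⟨Λ, hΛ⟩ : ∃ Λ : ℝ≥0, ‖T0‖ + c/4 ≤ Λ := ⟨⟨‖T0‖ + c/4, by positivity⟩, le_rfl⟩
  refine dyadic_sum _ (fun j => (2*2^(n+2)*(1+K*Q)^2) * (((2:ℝ≥0∞)^(n+2))^j *
        ∫⁻ y in ball (f z) (1 * (2:ℝ)⁻¹^j), infEDist y (f '' closure Z)^2 ∂(μ.restrict (ball 0 N)))
      + (2*2^(n+2)*(2*(K+Λ:ℝ≥0)^2)) * (((2:ℝ≥0∞)^(n+2))^j *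
        ∫⁻ w in ball z (((2*A:ℕ):ℝ) * (2:ℝ)⁻¹^j), infEDist w (closure Z)^2 ∂((μ.restrict (ball 0 N)).map q))
      + (2*2^(n+2)*Λ^n*cH*K^2) * (((2:ℝ≥0∞)^(n+2))^j *
        ∫⁻ w in ball z (((2*A:ℕ):ℝ) * (2:ℝ)⁻¹^j), infEDist w (closure Z)^2 ∂(volume.restrict (ball 0 (N':ℝ))))
      + (2*2^(n+2)*(2*9^n*(volume (ball (0:EE n) 1))⁻¹*M+Λ^n*cH)*C*ENNReal.ofReal ((2*A:ℕ):ℝ)^n) *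
        (4^j * WW f z (((2*A:ℕ):ℝ) * (2:ℝ)⁻¹^j))) j0 (trivial_bd μ (f z) hxs hfin T0 c hc hT0 hinj) ?_ ?_
  · intro j hj r hr
    obtain ⟨a, T, ha, hT, hH⟩ := hloc (((2*A:ℕ):ℝ) * (2:ℝ)⁻¹^j) (by positivity) (hj0 j hj)
    refine scale_bd μ N f K hf q Q hq Z hqf M hM hS z hz hN cH hcH T0 T a c hc hT0 A hA1 hA2 j
      Λ hΛ ha hT C hH (N':ℝ) ?_ r hr
    refine ball_subset_ball' ?_
    rw [dist_zero_right]; linarith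
  · refine tsum_lt_four _ _ _ _ _ _ _ _ ?_ ?_ ?_ ?_ g1 (g2 (2*A) hAn) (g3 (2*A) hAn N') (g4 (2*A) hAn)
    all_goals finiteness

lemma ae_Z {n d : ℕ} (μ : Measure (EE d)) (N : ℝ) [IsFiniteMeasure (μ.restrict (ball 0 N))]
    (f : EE n → EE d) (K : ℝ≥0) (hf : LipschitzWith K f)
    (q : EE d → EE n) (Q : ℝ≥0) (hq : LipschitzWith Q q) (Z : Set (EE n)) (hqf : ∀ z ∈ closure Z, q (f z) = z)
    (M : ℝ≥0∞) (hMt : M ≠ ⊤) (hM : ∀ z ∈ Z, ∀ r, 0 < r →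
      (μ.restrict (ball 0 N)).map q (closedBall z r) ≤ M * ENNReal.ofReal r ^ n)
    (hS : f '' closure Z ⊆ msupport μ) :
    ∀ᵐ z ∂(volume : Measure (EE n)), z ∈ Z → ball (f z) 1 ⊆ ball 0 N → DifferentiableAt ℝ f z →
      Function.Injective (fderiv ℝ f z) →
      ∫⁻ r in Ioo (0:ℝ) 1, bbeta2sq n μ (f z) r / ENNReal.ofReal r < ⊤ := by
  have hZm : MeasurableSet (closure Z) := isClosed_closure.measurableSet
  have hQ : ∀ z ∈ closure Z, ∀ z' ∈ closure Z, dist z z' ≤ Q * dist (f z) (f z') := by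
    intro z hz z' hz'
    conv_lhs => rw [← hqf z hz, ← hqf z' hz']
    exact hq.dist_le_mul _ _
  have g1 := (ae_restrict_iff' hZm).1 (marc f hf.continuous (closure Z) hZm Q hQ (μ.restrict (ball 0 N)) 1 one_pos)
  have g2 : ∀ᵐ z ∂(volume : Measure (EE n)), ∀ A : ℕ, 0 < A → z ∈ closure Z → ∑' j : ℕ, ((2:ℝ≥0∞)^(n+2))^j *
        ∫⁻ w in ball z ((A:ℝ) * (2:ℝ)⁻¹^j), infEDist w (closure Z)^2 ∂((μ.restrict (ball 0 N)).map q) < ⊤ := by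
    rw [ae_all_iff]; intro A
    rw [Filter.eventually_imp_distrib_left]; intro hA
    have := (ae_restrict_iff' hZm).1 (marc (id : EE n → EE n) continuous_id (closure Z) hZm 1 (by simp)
      ((μ.restrict (ball 0 N)).map q) A (by exact_mod_cast hA))
    simp only [image_id] at this
    exact this
  have g3 : ∀ᵐ z ∂(volume : Measure (EE n)), ∀ A : ℕ, 0 < A → ∀ N' : ℕ, z ∈ closure Z →
      ∑' j : ℕ, ((2:ℝ≥0∞)^(n+2))^j *
        ∫⁻ w in ball z ((A:ℝ) * (2:ℝ)⁻¹^j), infEDist w (closure Z)^2 ∂(volume.restrict (ball 0 (N':ℝ))) < ⊤ := by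
    rw [ae_all_iff]; intro A
    rw [Filter.eventually_imp_distrib_left]; intro hA
    rw [ae_all_iff]; intro N'
    have hfin : IsFiniteMeasure ((volume : Measure (EE n)).restrict (ball 0 (N':ℝ))) :=
      ⟨by rw [Measure.restrict_apply_univ]; exact measure_ball_lt_top⟩
    have := (ae_restrict_iff' hZm).1 (marc (id : EE n → EE n) continuous_id (closure Z) hZm 1 (by simp)
      ((volume : Measure (EE n)).restrict (ball 0 (N':ℝ))) A (by exact_mod_cast hA))
    simp only [image_id] at this
    exact this
  have g4 : ∀ᵐ z ∂(volume : Measure (EE n)), ∀ A : ℕ, 0 < A →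
      ∑' j : ℕ, (4:ℝ≥0∞)^j * WW f z ((A:ℝ) * (2:ℝ)⁻¹^j) < ⊤ := by
    rw [ae_all_iff]; intro A
    rw [Filter.eventually_imp_distrib_left]; intro hA
    exact WW_sum_ae f K hf A (by exact_mod_cast hA)
  filter_upwards [g1, g2, g3, g4] with z g1 g2 g3 g4 hz hN hd hinj
  have hz' := subset_closure hz
  exact pointwise μ N f K hf q Q hq Z hqf M hMt hM hS z hz' hN _ hd.hasFDerivAt hinj (g1 hz')
    (fun A hA => g2 A hA hz') (fun A hA N' => g3 A hA N' hz') g4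

lemma null_image {n d : ℕ} (μ : Measure (EE d)) (hμ : μ ≪ μH[(n:ℝ)]) (f : EE n → EE d) (K : ℝ≥0)
    (hf : LipschitzWith K f) (s : Set (EE n)) (hs : volume s = 0) : μ (f '' s) = 0 := by
  obtain ⟨cH, hcH⟩ := hausdorff_eq_smul n
  refine hμ ?_
  have h := hf.hausdorffMeasure_image_le (d := (n:ℝ)) (by positivity) s
  rw [hcH] at h
  simpa [hs] using h

lemma msupport_closed {d : ℕ} (μ : Measure (EE d)) : IsClosed (msupport μ) := by
  refine isClosed_of_closure_subset fun x hx => ?_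
  intro ε hε
  obtain ⟨y, hy, hxy⟩ := Metric.mem_closure_iff.1 hx (ε/2) (by positivity)
  refine (hy (ε/2) (by positivity)).trans_le (measure_mono (ball_subset_ball' ?_))
  rw [dist_comm]; linarith

lemma msupport_compl {d : ℕ} (μ : Measure (EE d)) : μ (msupport μ)ᶜ = 0 := by
  refine measure_null_of_locally_null _ fun x hx => ?_
  have : ∃ ε > 0, ¬ 0 < μ (ball x ε) := by
    by_contra hcon
    push Not at hcon
    exact hx fun ε hε => pos_iff_ne_zero.2 (fun h => by
      have := hcon ε hε
      simp [h] at this)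
  obtain ⟨ε, hε, h⟩ := this
  exact ⟨ball x ε, mem_nhdsWithin_of_mem_nhds (ball_mem_nhds x hε), by simpa using h⟩

def EEset {n d : ℕ} (μ : Measure (EE d)) (f : EE n → EE d) (k m N : ℕ) : Set (EE n) :=
  {z | z ∈ ball (TopologicalSpace.denseSeq (EE n) m) (1/(2*((k:ℝ)+1))) ∧ f z ∈ msupport μ ∧
    ball (f z) 1 ⊆ ball 0 N ∧ ∀ w ∈ ball z (1/((k:ℝ)+1)), dist w z ≤ ((k:ℝ)+1) * dist (f w) (f z)}

lemma ae_E {n d : ℕ} (μ : Measure (EE d)) [IsLocallyFiniteMeasure μ] (f : EE n → EE d) (K : ℝ≥0)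
    (hf : LipschitzWith K f) (k m N : ℕ) :
    ∀ᵐ z ∂(volume : Measure (EE n)), z ∈ EEset μ f k m N → DifferentiableAt ℝ f z →
      Function.Injective (fderiv ℝ f z) →
      ∫⁻ r in Ioo (0:ℝ) 1, bbeta2sq n μ (f z) r / ENNReal.ofReal r < ⊤ := by
  set E := EEset μ f k m N with hE
  have hfin : IsFiniteMeasure (μ.restrict (ball 0 (N:ℝ))) :=
    ⟨by rw [Measure.restrict_apply_univ]; exact measure_ball_lt_top⟩
  have hbl : ∀ z ∈ E, ∀ w ∈ E, dist w z ≤ ((k:ℝ)+1) * dist (f w) (f z) := by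
    intro z hz w hw
    refine hz.2.2.2 w ?_
    have h1 := mem_ball.1 hz.1
    have h2 := mem_ball.1 hw.1
    have h3 := dist_triangle_right w z (TopologicalSpace.denseSeq (EE n) m)
    rw [mem_ball]
    have h4 : 1/(2*((k:ℝ)+1)) + 1/(2*((k:ℝ)+1)) = 1/((k:ℝ)+1) := by field_simp; norm_num
    linarith
  have hinjE : InjOn f E := by
    intro z hz w hw h
    have := hbl w hw z hz
    rw [h, dist_self, mul_zero] at this
    exact dist_le_zero.1 this
  have hg : LipschitzOnWith ((k:ℝ≥0)+1) (Function.invFunOn f E) (f '' E) := by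
    refine LipschitzOnWith.of_dist_le_mul ?_
    rintro _ ⟨z, hz, rfl⟩ _ ⟨w, hw, rfl⟩
    rw [hinjE.leftInvOn_invFunOn hz, hinjE.leftInvOn_invFunOn hw]
    exact hbl w hw z hz
  obtain ⟨q, hq, hqe⟩ := hg.extend_finite_dimension
  have hqE : ∀ z ∈ E, q (f z) = z := by
    intro z hz
    rw [← hqe (mem_image_of_mem f hz)]
    exact hinjE.leftInvOn_invFunOn hz
  have hqc : ∀ Z ⊆ E, ∀ z ∈ closure Z, q (f z) = z := by
    intro Z hZ z hz
    have hcl : IsClosed {z | q (f z) = z} := isClosed_eq (hq.continuous.comp hf.continuous) continuous_id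
    exact closure_minimal (fun z hz => hqE z (hZ hz)) hcl hz
  have hSc : ∀ Z ⊆ E, f '' closure Z ⊆ msupport μ := by
    rintro Z hZ _ ⟨z, hz, rfl⟩
    have hcl : IsClosed (f ⁻¹' msupport μ) := (msupport_closed μ).preimage hf.continuous
    exact closure_minimal (fun z hz => (hZ hz).2.1) hcl hz
  have hdens := density_ae (n := n) ((μ.restrict (ball 0 (N:ℝ))).map q)
  have hall : ∀ᵐ z ∂(volume : Measure (EE n)), ∀ M : ℕ,
      z ∈ {z | z ∈ E ∧ ∀ r, 0 < r →
        (μ.restrict (ball 0 (N:ℝ))).map q (closedBall z r) ≤ M * ENNReal.ofReal r ^ n} →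
      ball (f z) 1 ⊆ ball 0 (N:ℝ) → DifferentiableAt ℝ f z →
      Function.Injective (fderiv ℝ f z) →
      ∫⁻ r in Ioo (0:ℝ) 1, bbeta2sq n μ (f z) r / ENNReal.ofReal r < ⊤ := by
    rw [ae_all_iff]; intro M
    have hsub : {z | z ∈ E ∧ ∀ r, 0 < r →
        (μ.restrict (ball 0 (N:ℝ))).map q (closedBall z r) ≤ M * ENNReal.ofReal r ^ n} ⊆ E := fun z hz => hz.1
    exact ae_Z μ N f K hf q _ hq _ (hqc _ hsub) M (by simp) (fun z hz => hz.2) (hSc _ hsub)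
  filter_upwards [hdens, hall] with z ⟨M, hM⟩ hall hz hd hi
  exact hall M ⟨hz, hM⟩ hz.2.2.1 hd hi

lemma mem_EEset {n d : ℕ} (μ : Measure (EE d)) (f : EE n → EE d) (z : EE n) (hz : f z ∈ msupport μ)
    (hd : DifferentiableAt ℝ f z) (hi : Function.Injective (fderiv ℝ f z)) :
    ∃ k m N, z ∈ EEset μ f k m N := by
  set T0 := fderiv ℝ f z with hT0
  obtain ⟨L, hL0, hL⟩ := (T0 : EE n →ₗ[ℝ] EE d).exists_antilipschitzWith (LinearMap.ker_eq_bot.2 hi)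
  have hL0' : (0:ℝ) < L := hL0
  have hLu : ∀ u, ‖u‖ ≤ L * ‖T0 u‖ := by
    intro u
    have := hL.le_mul_dist u 0
    simp only [dist_zero_right, map_zero] at this
    exact this
  have hlo := (hasFDerivAt_iff_isLittleO.1 hd.hasFDerivAt).def (c := 1/(2*L)) (by positivity)
  obtain ⟨ε, hε, hlo⟩ := Metric.eventually_nhds_iff_ball.1 hlo
  obtain ⟨k, hk⟩ := exists_nat_ge (max (1/ε) (2*L))
  have hk1 : 1/ε ≤ k := (le_max_left _ _).trans hk
  have hk2 : 2*L ≤ (k:ℝ) := (le_max_right _ _).trans hk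
  obtain ⟨N, hN⟩ := exists_nat_ge (1 + ‖f z‖)
  obtain ⟨m, hp⟩ := (TopologicalSpace.denseRange_denseSeq (EE n)).exists_dist_lt z
    (show 0 < 1/(2*((k:ℝ)+1)) by positivity)
  refine ⟨k, m, N, hp, hz, ball_subset_ball' (by rw [dist_zero_right]; exact hN), fun w hw => ?_⟩
  have hw' : w ∈ ball z ε := by
    refine ball_subset_ball ?_ hw
    rw [div_le_iff₀ (by positivity)]
    rw [div_le_iff₀ hε] at hk1
    nlinarith
  have h1 := hlo w hw'
  have h2 := hLu (w - z)
  have h3 : ‖T0 (w - z)‖ ≤ ‖f w - f z‖ + ‖f w - f z - T0 (w - z)‖ := by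
    have : T0 (w - z) = (f w - f z) - (f w - f z - T0 (w - z)) := by abel
    conv_lhs => rw [this]
    exact norm_sub_le _ _
  rw [dist_eq_norm, dist_eq_norm]
  have h4 : L * (1/(2*L) * ‖w - z‖) = ‖w - z‖/2 := by field_simp
  have h5 : ‖w - z‖ ≤ L * ‖f w - f z‖ + ‖w - z‖/2 := by
    rw [← h4, ← mul_add]
    exact h2.trans (by gcongr; linarith)
  have h6 : 2 * L * ‖f w - f z‖ ≤ (k + 1) * ‖f w - f z‖ := by gcongr; linarith
  linarith

lemma bad_null {n d : ℕ} (μ : Measure (EE d)) [IsLocallyFiniteMeasure μ] (hμ : μ ≪ μH[(n:ℝ)])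
    (f : EE n → EE d) (K : ℝ≥0) (hf : LipschitzWith K f) :
    μ (f '' {z | f z ∈ msupport μ ∧
      ¬ ∫⁻ r in Ioo (0:ℝ) 1, bbeta2sq n μ (f z) r / ENNReal.ofReal r < ⊤}) = 0 := by
  have h1 : ∀ᵐ z ∂(volume : Measure (EE n)), ∀ k m N, z ∈ EEset μ f k m N → DifferentiableAt ℝ f z →
      Function.Injective (fderiv ℝ f z) →
      ∫⁻ r in Ioo (0:ℝ) 1, bbeta2sq n μ (f z) r / ENNReal.ofReal r < ⊤ := by
    simp only [ae_all_iff]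
    exact fun k m N => ae_E μ f K hf k m N
  have h2 := h1.and (hf.ae_differentiableAt (μ := (volume : Measure (EE n))))
  have h3 := null_image μ hμ f K hf _ (ae_iff.1 h2)
  have h4 := hμ (degenerate_null f K hf)
  refine measure_mono_null ?_ (measure_union_null h3 h4)
  rw [← image_union]
  refine image_mono ?_
  rintro z ⟨hz, hbad⟩
  by_contra hcon
  simp only [mem_union, mem_ofPred_eq, not_or, not_not] at hcon
  obtain ⟨⟨ha, hd⟩, hb⟩ := hcon
  have hi : Function.Injective (fderiv ℝ f z) := by
    by_contra hi
    exact hb ⟨hd, hi⟩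
  obtain ⟨k, m, N, hE⟩ := mem_EEset μ f z hz hd hi
  exact hbad (ha k m N hE hd hi)

/-- If `μ` is `n`-rectifiable on `ℝ^d`, then for `μ`-a.e. `x`,
`∫_0^1 bβ_{μ,2}(x,r)^2 dr/r < ∞`. -/
theorem bbeta2_square_function_finite {d n : ℕ} (μ : Measure (EuclideanSpace ℝ (Fin d)))
    [IsLocallyFiniteMeasure μ] (hμ : IsRectifiableMeasure n μ) :
    ∀ᵐ x ∂μ, (∫⁻ r in Set.Ioo (0 : ℝ) 1, bbeta2sq n μ x r / ENNReal.ofReal r) < ⊤ := by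
  obtain ⟨hac, f, hf, hcov⟩ := hμ
  choose K hK using hf
  have h1 := msupport_compl μ
  have h2 : μ (⋃ i, f i '' {z | f i z ∈ msupport μ ∧
      ¬ ∫⁻ r in Ioo (0:ℝ) 1, bbeta2sq n μ (f i z) r / ENNReal.ofReal r < ⊤}) = 0 :=
    measure_iUnion_null fun i => bad_null μ hac (f i) (K i) (hK i)
  rw [ae_iff]
  refine measure_mono_null ?_ (measure_union_null (measure_union_null h1 hcov) h2)
  intro x hx
  by_cases hs : x ∈ msupport μ
  · by_cases hr : x ∈ ⋃ i, range (f i)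
    · right
      obtain ⟨i, z, rfl⟩ := mem_iUnion.1 hr
      exact mem_iUnion.2 ⟨i, z, ⟨hs, hx⟩, rfl⟩
    · exact Or.inl (Or.inr ⟨mem_univ _, hr⟩)
  · exact Or.inl (Or.inl hs)
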